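/- Let S ⊆ Γ = SL₂(ℤ)×SL₂(ℤ)×SL₂(ℤ) be a finite symmetric set generating a group that is Zariski-dense in SL₂×SL₂×SL₂. Then there exist constants c₁, c₂ > 0 and l₀ ∈ ℤ₊, depending only on S, such that for every primitive linear form L, every positive integer Q, every n ∈ ℤ, and every integer l with l₀ ≤ l < c₁ log Q, one has χ_S^{(l)}({g ∈ Γ : L(g) ≡ n (mod Q)}) < e^{−c₂ l}. -/

import Mathlib

open Matrix Pointwise

abbrev SL2Z := Matrix.SpecialLinearGroup (Fin 2) ℤ
abbrev SL2C := Matrix.SpecialLinearGroup (Fin 2) ℂ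
abbrev GammaSL : Type := SL2Z × SL2Z × SL2Z
abbrev GammaC : Type := SL2C × SL2C × SL2C

def entryZ (g : GammaSL) : Fin 3 × Fin 2 × Fin 2 → ℤ :=
  fun x => ![(g.1 : Matrix (Fin 2) (Fin 2) ℤ), (g.2.1 : Matrix (Fin 2) (Fin 2) ℤ),
    (g.2.2 : Matrix (Fin 2) (Fin 2) ℤ)] x.1 x.2.1 x.2.2

noncomputable def entryC (g : GammaC) : Fin 3 × Fin 2 × Fin 2 → ℂ :=
  fun x => ![(g.1 : Matrix (Fin 2) (Fin 2) ℂ), (g.2.1 : Matrix (Fin 2) (Fin 2) ℂ),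
    (g.2.2 : Matrix (Fin 2) (Fin 2) ℂ)] x.1 x.2.1 x.2.2

/-- Zariski density of a subgroup of `SL₂(ℤ)³` in `SL₂ × SL₂ × SL₂`. -/
def ZariskiDense (G : Subgroup GammaSL) : Prop :=
  ∀ P : MvPolynomial (Fin 3 × Fin 2 × Fin 2) ℚ,
    (∀ g ∈ G, (MvPolynomial.aeval (fun x => (entryZ g x : ℂ))) P = 0) →
    ∀ h : GammaC, (MvPolynomial.aeval (entryC h)) P = 0

/-- Entrywise reduction mod `q` on `SL₂(ℤ)`. -/
def redSL (q : ℕ) : SL2Z →* Matrix.SpecialLinearGroup (Fin 2) (ZMod q) :=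
  Matrix.SpecialLinearGroup.map (Int.castRingHom (ZMod q))

abbrev GammaMod (q : ℕ) : Type :=
  Matrix.SpecialLinearGroup (Fin 2) (ZMod q) × Matrix.SpecialLinearGroup (Fin 2) (ZMod q) ×
    Matrix.SpecialLinearGroup (Fin 2) (ZMod q)

/-- Entrywise reduction mod `q` on `Γ = SL₂(ℤ)³`. -/
def piq (q : ℕ) : GammaSL →* GammaMod q :=
  (redSL q).prodMap ((redSL q).prodMap (redSL q))

/-- convolution on Γ -/
noncomputable def convG (f g : GammaSL → ℝ) : GammaSL → ℝ := fun x => ∑ᶠ y, f y * g (x * y⁻¹)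

/-- normalized counting measure on S -/
noncomputable def chiS (S : Set GammaSL) : GammaSL → ℝ := S.indicator fun _ => (S.ncard : ℝ)⁻¹

/-- l-fold convolution of χ_S with itself -/
noncomputable def chiIter (S : Set GammaSL) : ℕ → GammaSL → ℝ
  | 0 => fun x => open Classical in if x = 1 then 1 else 0
  | n + 1 => convG (chiS S) (chiIter S n)

/-- The linear form with coefficients `X` evaluated at `g ∈ Γ`. -/
def Lform (X : Fin 3 × Fin 2 × Fin 2 → ℤ) (g : GammaSL) : ℤ :=
  ∑ i : Fin 3 × Fin 2 × Fin 2, X i * entryZ g i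

/-- A primitive linear form: the 12 integer coefficients have gcd 1. -/
def PrimitiveForm (X : Fin 3 × Fin 2 × Fin 2 → ℤ) : Prop :=
  Finset.univ.gcd X = 1

section Walk

variable {G : Type*} [Group G]

/-- The expectation of a function of the position at time `n` of the random walk on `G` whose
steps are uniformly distributed on `S`. -/
noncomputable def walkExp (S : Finset G) : ℕ → (G → ℝ) →ₗ[ℝ] ℝ
  | 0 => LinearMap.proj 1
  | n + 1 => (S.card : ℝ)⁻¹ • ∑ s ∈ S, walkExp S n ∘ₗ LinearMap.funLeft ℝ ℝ (· * s)

variable {S : Finset G}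

theorem walkExp_zero (F : G → ℝ) : walkExp S 0 F = F 1 := rfl

theorem walkExp_succ (n : ℕ) (F : G → ℝ) :
    walkExp S (n + 1) F = (S.card : ℝ)⁻¹ * ∑ s ∈ S, walkExp S n fun g => F (g * s) := by
  simp only [walkExp, LinearMap.smul_apply, LinearMap.sum_apply]
  rfl

theorem walkExp_mono (n : ℕ) {F F' : G → ℝ} (h : ∀ g, F g ≤ F' g) :
    walkExp S n F ≤ walkExp S n F' := by
  induction n generalizing F F' with
  | zero => exact h 1
  | succ n ih =>
    rw [walkExp_succ, walkExp_succ]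
    gcongr with s
    exact ih fun g => h _

theorem walkExp_const (hS : S.Nonempty) (n : ℕ) (c : ℝ) : walkExp S n (fun _ => c) = c := by
  induction n with
  | zero => rfl
  | succ n ih =>
    have : (S.card : ℝ) ≠ 0 := by exact_mod_cast hS.card_ne_zero
    rw [walkExp_succ, ih]
    simp [this]

theorem walkExp_nonneg (n : ℕ) {F : G → ℝ} (h : ∀ g, 0 ≤ F g) : 0 ≤ walkExp S n F := by
  have := walkExp_mono (S := S) n h
  rwa [show (fun _ : G => (0 : ℝ)) = 0 from rfl, map_zero] at this

theorem walkExp_comm (m n : ℕ) (K : G → G → ℝ) :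
    walkExp S m (fun h => walkExp S n (K h)) =
      walkExp S n fun g => walkExp S m fun h => K h g := by
  induction m generalizing K with
  | zero => rfl
  | succ m ih =>
    simp only [walkExp_succ]
    simp_rw [fun s => ih fun h g => K (h * s) g]
    rw [← map_sum, ← smul_eq_mul, ← map_smul]
    congr 1
    ext g
    simp

theorem walkExp_add (m n : ℕ) (F : G → ℝ) :
    walkExp S (m + n) F = walkExp S m fun h => walkExp S n fun g => F (h * g) := by
  induction n generalizing F with
  | zero => simp [walkExp_zero]
  | succ n ih =>
    rw [← add_assoc, walkExp_succ]
    simp_rw [ih, walkExp_succ]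
    rw [← map_sum, ← smul_eq_mul, ← map_smul]
    congr 1
    ext h
    simp [mul_assoc]

theorem walkExp_sq_le (hS : S.Nonempty) (n : ℕ) (F : G → ℝ) :
    walkExp S n F ^ 2 ≤ walkExp S n fun g => F g ^ 2 := by
  set m := walkExp S n F with hm
  have h : 0 ≤ walkExp S n fun g => (F g - m) ^ 2 := walkExp_nonneg n fun g => sq_nonneg _
  have e : (fun g => (F g - m) ^ 2) =
      (fun g => F g ^ 2) - (2 * m) • F + fun _ => m ^ 2 := by
    ext g
    simp
    ring
  rw [e, map_add, map_sub, map_smul, walkExp_const hS, ← hm, smul_eq_mul] at h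
  nlinarith

/-- Averaging a function on a `G`-set over the inverses of the elements of `S`. -/
noncomputable def avgOp {X : Type*} [MulAction G X] (S : Finset G) (f : X → ℝ) : X → ℝ :=
  fun x => (S.card : ℝ)⁻¹ * ∑ s ∈ S, f (s⁻¹ • x)

theorem walkExp_inv_smul {X : Type*} [MulAction G X] (n : ℕ) (f : X → ℝ) (x : X) :
    walkExp S n (fun h => f (h⁻¹ • x)) = (avgOp S)^[n] f x := by
  induction n generalizing f with
  | zero => simp [walkExp_zero]
  | succ n ih =>
    rw [walkExp_succ, Function.iterate_succ_apply, ← ih, ← map_sum, ← smul_eq_mul, ← map_smul]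
    congr 1
    ext h
    simp [avgOp, mul_smul]

end Walk

section Gap

variable {G : Type*} [Group G] {X : Type*} [MulAction G X]

/-- The squared `ℓ²`-distance of a function on a `G`-set to its translate. -/
noncomputable def shiftDist (f : X → ℝ) (t : G) : ℝ := ∑' x, (f (t • x) - f x) ^ 2

theorem support_comp_smul_finite {f : X → ℝ} (hf : f.support.Finite) (t : G) :
    (fun x => f (t • x)).support.Finite :=
  hf.preimage (MulAction.injective t).injOn

theorem tsum_comp_smul (F : X → ℝ) (t : G) : ∑' x, F (t • x) = ∑' x, F x :=
  (MulAction.toPerm t).tsum_eq F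

theorem summable_of_support_subset {f F : X → ℝ} (hf : f.support.Finite)
    (h : ∀ x, f x = 0 → F x = 0) : Summable F :=
  summable_of_hasFiniteSupport (hf.subset fun x hx hfx => hx (h x hfx))

theorem summable_of_support_subset₂ {f g F : X → ℝ} (hf : f.support.Finite)
    (hg : g.support.Finite) (h : ∀ x, f x = 0 → g x = 0 → F x = 0) : Summable F := by
  refine summable_of_hasFiniteSupport ((hf.union hg).subset fun x hx => ?_)
  by_contra hc
  simp only [Set.mem_union, Function.mem_support, not_or, not_not] at hc
  exact hx (h x hc.1 hc.2)

theorem shiftDist_nonneg (f : X → ℝ) (t : G) : 0 ≤ shiftDist f t :=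
  tsum_nonneg fun _ => sq_nonneg _

theorem shiftDist_one (f : X → ℝ) : shiftDist f (1 : G) = 0 := by
  simp [shiftDist]

theorem shiftDist_inv (f : X → ℝ) (t : G) : shiftDist f t⁻¹ = shiftDist f t := by
  rw [shiftDist, shiftDist, ← tsum_comp_smul (fun x => (f (t⁻¹ • x) - f x) ^ 2) t]
  refine tsum_congr fun x => ?_
  rw [inv_smul_smul]
  ring

theorem shiftDist_mul_le {f : X → ℝ} (hf : f.support.Finite) (s t : G) :
    shiftDist f (s * t) ≤ 2 * shiftDist f s + 2 * shiftDist f t := by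
  have h1 : shiftDist f s = ∑' x, (f (s • t • x) - f (t • x)) ^ 2 :=
    (tsum_comp_smul (fun x => (f (s • x) - f x) ^ 2) t).symm
  have hs := support_comp_smul_finite hf t
  have hst : (fun x => f (s • t • x)).support.Finite := by
    simpa only [mul_smul] using support_comp_smul_finite hf (s * t)
  have a1 : Summable fun x => (f (s • t • x) - f (t • x)) ^ 2 :=
    summable_of_support_subset₂ hst hs fun x h h' => by simp_all
  have a2 : Summable fun x => (f (t • x) - f x) ^ 2 :=
    summable_of_support_subset₂ hs hf fun x h h' => by simp_all
  have a3 : Summable fun x => (f (s • t • x) - f x) ^ 2 :=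
    summable_of_support_subset₂ hst hf fun x h h' => by simp_all
  rw [h1, shiftDist, shiftDist, ← tsum_mul_left, ← tsum_mul_left,
    ← (a1.mul_left 2).tsum_add (a2.mul_left 2)]
  simp_rw [mul_smul]
  refine a3.tsum_le_tsum (fun x => ?_) ((a1.mul_left 2).add (a2.mul_left 2))
  nlinarith [sq_nonneg (f (s • t • x) - 2 * f (t • x) + f x)]

theorem exists_shiftDist_le {S : Finset G} {t : G} (ht : t ∈ Subgroup.closure (S : Set G)) :
    ∃ M : ℝ, 0 ≤ M ∧ ∀ {X : Type*} [MulAction G X] (f : X → ℝ), f.support.Finite →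
      shiftDist f t ≤ M * ∑ s ∈ S, shiftDist f s := by
  induction ht using Subgroup.closure_induction with
  | mem s hs =>
    refine ⟨1, zero_le_one, fun f _ => ?_⟩
    rw [one_mul]
    exact Finset.single_le_sum (f := fun s => shiftDist f s) (fun s _ => shiftDist_nonneg f s) hs
  | one => exact ⟨0, le_rfl, fun f _ => by simp [shiftDist_one]⟩
  | mul s t _ _ hs ht =>
    obtain ⟨M, hM, h⟩ := hs
    obtain ⟨M', hM', h'⟩ := ht
    refine ⟨2 * M + 2 * M', by positivity, fun f hf => ?_⟩
    linarith [shiftDist_mul_le hf s t, h f hf, h' f hf]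
  | inv t _ ht =>
    obtain ⟨M, hM, h⟩ := ht
    exact ⟨M, hM, fun f hf => by rw [shiftDist_inv]; exact h f hf⟩

theorem tsum_abs_sq_sub_le {f : X → ℝ} (hf : f.support.Finite) (t : G) {η : ℝ} (hη : 0 < η) :
    ∑' x, |f (t • x) ^ 2 - f x ^ 2| ≤ shiftDist f t / (2 * η) + 2 * η * ∑' x, f x ^ 2 := by
  have hs := support_comp_smul_finite hf t
  have a1 : Summable fun x => |f (t • x) ^ 2 - f x ^ 2| :=
    summable_of_support_subset₂ hs hf fun x h h' => by simp_all
  have a2 : Summable fun x => (f (t • x) - f x) ^ 2 :=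
    summable_of_support_subset₂ hs hf fun x h h' => by simp_all
  have a3 : Summable fun x => f (t • x) ^ 2 := summable_of_support_subset hs (by simp_all)
  have a4 : Summable fun x => f x ^ 2 := summable_of_support_subset hf (by simp_all)
  have e : ∑' x, f (t • x) ^ 2 = ∑' x, f x ^ 2 := tsum_comp_smul (fun x => f x ^ 2) t
  calc ∑' x, |f (t • x) ^ 2 - f x ^ 2|
      ≤ ∑' x, ((2 * η)⁻¹ * (f (t • x) - f x) ^ 2 + (η * f (t • x) ^ 2 + η * f x ^ 2)) := by
        refine a1.tsum_le_tsum (fun x => ?_)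
          ((a2.mul_left _).add ((a3.mul_left _).add (a4.mul_left _)))
        set a := f (t • x)
        set b := f x
        have h1 : |a ^ 2 - b ^ 2| = |a - b| * |a + b| := by rw [← abs_mul]; ring_nf
        have h2 : |a - b| * |a + b| ≤ (2 * η)⁻¹ * |a - b| ^ 2 + η / 2 * |a + b| ^ 2 := by
          have := sq_nonneg (|a - b| - η * |a + b|)
          have h3 : (2 * η)⁻¹ * |a - b| ^ 2 + η / 2 * |a + b| ^ 2 - |a - b| * |a + b| =
            (2 * η)⁻¹ * (|a - b| - η * |a + b|) ^ 2 := by field_simp; ring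
          have h4 : 0 ≤ (2 * η)⁻¹ * (|a - b| - η * |a + b|) ^ 2 := by positivity
          linarith
        rw [sq_abs, sq_abs] at h2
        nlinarith [mul_nonneg hη.le (sq_nonneg (a - b))]
    _ = shiftDist f t / (2 * η) + 2 * η * ∑' x, f x ^ 2 := by
        rw [(a2.mul_left _).tsum_add ((a3.mul_left _).add (a4.mul_left _)),
          (a3.mul_left _).tsum_add (a4.mul_left _), tsum_mul_left, tsum_mul_left, tsum_mul_left,
          e, shiftDist]
        ring

open Classical in
/-- If finitely many elements of `G` play ping-pong on `X` with sets of bounded multiplicity,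
then no finitely supported function is almost invariant. -/
theorem sum_sq_le_of_pingpong {ι : Type*} [Fintype ι] [Nonempty ι] (t : ι → G) (B N : ι → Set X)
    (hBN : ∀ i x, x ∉ N i → t i • x ∈ B i)
    (hmult : ∀ x, (∑ i, ((if x ∈ B i then 1 else 0) + if x ∈ N i then 1 else 0 : ℝ)) + 1 ≤
      Fintype.card ι)
    {f : X → ℝ} (hf : f.support.Finite) :
    ∑' x, f x ^ 2 ≤ 8 * Fintype.card ι * ∑ i, shiftDist f (t i) := by
  set K : ℝ := (Fintype.card ι : ℝ) with hK
  have hKpos : 0 < K := by rw [hK]; exact_mod_cast Fintype.card_pos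
  have a4 : Summable fun x => f x ^ 2 := summable_of_support_subset hf (by simp_all)
  have key (i : ι) : ∑' x, f x ^ 2 ≤
      ∑' x, ((if x ∈ B i then 1 else 0) + if x ∈ N i then 1 else 0) * f x ^ 2 +
        (4 * K * shiftDist f (t i) + (2 * K)⁻¹ * ∑' x, f x ^ 2) := by
    have hs := support_comp_smul_finite hf (t i)
    have b1 : Summable fun x => (if x ∈ B i then 1 else 0) * f x ^ 2 :=
      summable_of_support_subset hf (by simp_all)
    have b2 : Summable fun x => (if x ∈ N i then 1 else 0) * f x ^ 2 :=
      summable_of_support_subset hf (by simp_all)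
    have b3 : Summable fun x => (if t i • x ∈ B i then 1 else 0) * f (t i • x) ^ 2 :=
      summable_of_support_subset hs (by simp_all)
    have b4 : Summable fun x => |f (t i • x) ^ 2 - f x ^ 2| :=
      summable_of_support_subset₂ hs hf fun x h h' => by simp_all
    have h1 := tsum_abs_sq_sub_le hf (t i) (η := (4 * K)⁻¹) (by positivity)
    have h2 : ∑' x, f x ^ 2 ≤ ∑' x, ((if t i • x ∈ B i then 1 else 0) * f (t i • x) ^ 2 +
        (if x ∈ N i then 1 else 0) * f x ^ 2 + |f (t i • x) ^ 2 - f x ^ 2|) := by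
      refine a4.tsum_le_tsum (fun x => ?_) ((b3.add b2).add b4)
      by_cases hx : x ∈ N i
      · rw [if_pos hx, one_mul]
        have : 0 ≤ (if t i • x ∈ B i then 1 else 0) * f (t i • x) ^ 2 := by positivity
        linarith [abs_nonneg (f (t i • x) ^ 2 - f x ^ 2)]
      · rw [if_neg hx, if_pos (hBN i x hx)]
        linarith [neg_abs_le (f (t i • x) ^ 2 - f x ^ 2)]
    rw [(b3.add b2).tsum_add b4, b3.tsum_add b2,
      tsum_comp_smul (fun x => (if x ∈ B i then 1 else 0) * f x ^ 2) (t i), ← b1.tsum_add b2] at h2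
    simp_rw [← add_mul] at h2
    have e1 : shiftDist f (t i) / (2 * (4 * K)⁻¹) = 2 * K * shiftDist f (t i) := by
      field_simp; ring
    have e2 : 2 * (4 * K)⁻¹ = (2 * K)⁻¹ := by field_simp; norm_num
    rw [e1, e2] at h1
    nlinarith [mul_nonneg hKpos.le (shiftDist_nonneg f (t i))]
  have hsum := Finset.sum_le_sum fun i (_ : i ∈ Finset.univ) => key i
  have c1 : ∀ i ∈ (Finset.univ : Finset ι),
      Summable fun x => ((if x ∈ B i then 1 else 0) + if x ∈ N i then 1 else 0) * f x ^ 2 :=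
    fun i _ => summable_of_support_subset hf (by simp_all)
  rw [Finset.sum_add_distrib, ← Summable.tsum_finsetSum c1, Finset.sum_add_distrib,
    ← Finset.mul_sum, Finset.sum_const, Finset.sum_const, Finset.card_univ, nsmul_eq_mul,
    nsmul_eq_mul, ← hK] at hsum
  have h3 : ∑' x, ∑ i, ((if x ∈ B i then 1 else 0) + if x ∈ N i then 1 else 0) * f x ^ 2 ≤
      ∑' x, (K - 1) * f x ^ 2 := by
    refine (summable_sum c1).tsum_le_tsum (fun x => ?_) (a4.mul_left _)
    rw [← Finset.sum_mul]
    gcongr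
    linarith [hmult x]
  rw [tsum_mul_left] at h3
  have e3 : K * ((2 * K)⁻¹ * ∑' x, f x ^ 2) = (∑' x, f x ^ 2) / 2 := by field_simp
  rw [e3] at hsum
  linarith

end Gap

section Contraction

variable {G : Type*} [Group G] {X : Type*} [MulAction G X] {S : Finset G}

theorem avgOp_support_finite (S : Finset G) {f : X → ℝ} (hf : f.support.Finite) :
    (avgOp S f).support.Finite := by
  refine (S.finite_toSet.biUnion fun s _ => support_comp_smul_finite hf s⁻¹).subset fun x hx => ?_
  simp only [Set.mem_iUnion, Function.mem_support]
  by_contra! hc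
  exact hx (by rw [avgOp, Finset.sum_eq_zero fun s hs => hc s hs, mul_zero])

theorem tsum_avgOp_mul {f g : X → ℝ} (hf : f.support.Finite) :
    ∑' x, avgOp S f x * g x = (S.card : ℝ)⁻¹ * ∑ s ∈ S, ∑' x, f (s⁻¹ • x) * g x := by
  rw [← Summable.tsum_finsetSum fun s _ => summable_of_support_subset
    (support_comp_smul_finite hf s⁻¹) (by simp_all), ← tsum_mul_left]
  simp_rw [avgOp, ← Finset.sum_mul, mul_assoc]

theorem tsum_avgOp_mul_comm (hS : ∀ s ∈ S, s⁻¹ ∈ S) {f g : X → ℝ} (hf : f.support.Finite)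
    (hg : g.support.Finite) : ∑' x, avgOp S f x * g x = ∑' x, avgOp S g x * f x := by
  rw [tsum_avgOp_mul hf, tsum_avgOp_mul hg]
  congr 1
  refine Finset.sum_nbij' (·⁻¹) (·⁻¹) hS hS (by simp) (by simp) fun s _ => ?_
  rw [← tsum_comp_smul (fun x => f (s⁻¹ • x) * g x) s]
  simp [mul_comm]

theorem tsum_avgOp_mul_self_le (hSne : S.Nonempty) {M : ℝ} (hM : 0 < M) {f : X → ℝ}
    (hf : f.support.Finite) (hgap : ∑' x, f x ^ 2 ≤ M * ∑ s ∈ S, shiftDist f s) :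
    ∑' x, avgOp S f x * f x ≤ (1 - (2 * M * S.card)⁻¹) * ∑' x, f x ^ 2 := by
  have hc : (0 : ℝ) < S.card := by exact_mod_cast hSne.card_pos
  have key (s : G) : ∑' x, f (s⁻¹ • x) * f x = ∑' x, f x ^ 2 - shiftDist f s / 2 := by
    have hs := support_comp_smul_finite hf s⁻¹
    have a1 : Summable fun x => f (s⁻¹ • x) * f x := summable_of_support_subset hf (by simp_all)
    have a2 : Summable fun x => f x ^ 2 := summable_of_support_subset hf (by simp_all)
    have a3 : Summable fun x => f (s⁻¹ • x) ^ 2 := summable_of_support_subset hs (by simp_all)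
    have e : ∑' x, f (s⁻¹ • x) ^ 2 = ∑' x, f x ^ 2 := tsum_comp_smul (fun x => f x ^ 2) s⁻¹
    have h : shiftDist f s⁻¹ = ∑' x, f (s⁻¹ • x) ^ 2 + ∑' x, f x ^ 2
        - 2 * ∑' x, f (s⁻¹ • x) * f x := by
      rw [← a3.tsum_add a2, ← tsum_mul_left, ← (a3.add a2).tsum_sub (a1.mul_left 2), shiftDist]
      exact tsum_congr fun x => by ring
    rw [shiftDist_inv, e] at h
    linarith
  rw [tsum_avgOp_mul hf]
  simp_rw [key]
  rw [Finset.sum_sub_distrib, ← Finset.sum_div, Finset.sum_const, nsmul_eq_mul]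
  have e1 : (S.card : ℝ)⁻¹ * (S.card * ∑' x, f x ^ 2 - (∑ s ∈ S, shiftDist f s) / 2) =
      ∑' x, f x ^ 2 - (2 * M * S.card)⁻¹ * (M * ∑ s ∈ S, shiftDist f s) := by field_simp
  rw [e1, sub_mul, one_mul]
  gcongr

theorem tsum_avgOp_sq_le (hS : ∀ s ∈ S, s⁻¹ ∈ S) {ρ : ℝ} (hρ : 0 < ρ)
    (h : ∀ f : X → ℝ, f.support.Finite → ∑' x, avgOp S f x * f x ≤ ρ * ∑' x, f x ^ 2)
    {f : X → ℝ} (hf : f.support.Finite) :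
    ∑' x, avgOp S f x ^ 2 ≤ ρ ^ 2 * ∑' x, f x ^ 2 := by
  have habs : ∀ u : X → ℝ, u.support.Finite →
      -∑' x, avgOp S u x * u x ≤ ρ * ∑' x, u x ^ 2 := fun u hu => by
    have hu' : (fun x => |u x|).support.Finite := hu.subset fun x hx => by simpa using hx
    have h1 := h _ hu'
    simp only [sq_abs] at h1
    refine le_trans ?_ h1
    rw [← tsum_neg]
    have s1 := avgOp_support_finite S hu
    have s2 := avgOp_support_finite S hu'
    have a1 : Summable fun x => -(avgOp S u x * u x) := summable_of_support_subset hu (by simp_all)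
    refine a1.tsum_le_tsum (fun x => ?_) (summable_of_support_subset hu (by simp_all))
    refine (neg_le_abs _).trans ?_
    rw [abs_mul]
    gcongr
    rw [avgOp, avgOp, abs_mul, abs_of_nonneg (by positivity : (0 : ℝ) ≤ (S.card : ℝ)⁻¹)]
    gcongr
    exact Finset.abs_sum_le_sum_abs _ _
  set T := avgOp S f with hT
  have hTf : T.support.Finite := avgOp_support_finite S hf
  set g : X → ℝ := fun x => ρ⁻¹ * T x with hg
  have hgf : g.support.Finite := hTf.subset fun x hx hx' => hx (by simp [hg, hx'])
  have hp : (f + g).support.Finite := (hf.union hgf).subset (Function.support_add f g)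
  have hm : (f - g).support.Finite := (hf.union hgf).subset (Function.support_sub f g)
  have eadd (x : X) : avgOp S (f + g) x = avgOp S f x + avgOp S g x := by
    simp [avgOp, Finset.sum_add_distrib, mul_add]
  have esub (x : X) : avgOp S (f - g) x = avgOp S f x - avgOp S g x := by
    simp [avgOp, Finset.sum_sub_distrib, mul_sub]
  have hcomm := tsum_avgOp_mul_comm hS hf hgf
  have q1 : Summable fun x => avgOp S f x * f x := summable_of_support_subset hf (by simp_all)
  have q2 : Summable fun x => avgOp S f x * g x :=
    summable_of_support_subset hgf fun x hx => by rw [hx, mul_zero]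
  have q3 : Summable fun x => avgOp S g x * f x :=
    summable_of_support_subset hf fun x hx => by rw [hx, mul_zero]
  have q4 : Summable fun x => avgOp S g x * g x :=
    summable_of_support_subset hgf fun x hx => by rw [hx, mul_zero]
  have p1 : Summable fun x => f x ^ 2 := summable_of_support_subset hf (by simp_all)
  have p2 : Summable fun x => g x ^ 2 :=
    summable_of_support_subset hgf fun x hx => by rw [hx]; norm_num
  have p3 : Summable fun x => f x * g x := summable_of_support_subset hf (by simp_all)
  have E1 : ∑' x, avgOp S (f + g) x * (f + g) x = ∑' x, avgOp S f x * f x +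
      ∑' x, avgOp S f x * g x + (∑' x, avgOp S g x * f x + ∑' x, avgOp S g x * g x) := by
    rw [← q1.tsum_add q2, ← q3.tsum_add q4, ← (q1.add q2).tsum_add (q3.add q4)]
    refine tsum_congr fun x => ?_
    rw [eadd, Pi.add_apply]; ring
  have E2 : ∑' x, avgOp S (f - g) x * (f - g) x = ∑' x, avgOp S f x * f x -
      ∑' x, avgOp S f x * g x - (∑' x, avgOp S g x * f x - ∑' x, avgOp S g x * g x) := by
    rw [← q1.tsum_sub q2, ← q3.tsum_sub q4, ← (q1.sub q2).tsum_sub (q3.sub q4)]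
    refine tsum_congr fun x => ?_
    rw [esub, Pi.sub_apply]; ring
  have E3 : ∑' x, (f + g) x ^ 2 = ∑' x, f x ^ 2 + ∑' x, g x ^ 2 + 2 * ∑' x, f x * g x := by
    rw [← p1.tsum_add p2, ← tsum_mul_left, ← (p1.add p2).tsum_add (p3.mul_left 2)]
    refine tsum_congr fun x => ?_
    rw [Pi.add_apply]; ring
  have E4 : ∑' x, (f - g) x ^ 2 = ∑' x, f x ^ 2 + ∑' x, g x ^ 2 - 2 * ∑' x, f x * g x := by
    rw [← p1.tsum_add p2, ← tsum_mul_left, ← (p1.add p2).tsum_sub (p3.mul_left 2)]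
    refine tsum_congr fun x => ?_
    rw [Pi.sub_apply]; ring
  have H1 := h _ hp
  have H2 := habs _ hm
  rw [E1, E3] at H1
  rw [E2, E4] at H2
  have E5 : ∑' x, avgOp S f x * g x = ρ⁻¹ * ∑' x, T x ^ 2 := by
    rw [← tsum_mul_left]
    exact tsum_congr fun x => by rw [hg, ← hT]; ring
  have E6 : ∑' x, g x ^ 2 = ρ⁻¹ ^ 2 * ∑' x, T x ^ 2 := by
    rw [← tsum_mul_left]
    exact tsum_congr fun x => by rw [hg]; ring
  rw [← hcomm, E5, E6] at H1 H2
  have H3 : 4 * (ρ⁻¹ * ∑' x, T x ^ 2) ≤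
      2 * ρ * (∑' x, f x ^ 2 + ρ⁻¹ ^ 2 * ∑' x, T x ^ 2) := by linarith
  have e7 : 2 * ρ * (∑' x, f x ^ 2 + ρ⁻¹ ^ 2 * ∑' x, T x ^ 2) =
      2 * ρ * ∑' x, f x ^ 2 + 2 * (ρ⁻¹ * ∑' x, T x ^ 2) := by field_simp
  rw [e7] at H3
  have H4 : ρ⁻¹ * ∑' x, T x ^ 2 ≤ ρ * ∑' x, f x ^ 2 := by linarith
  calc ∑' x, T x ^ 2 = ρ * (ρ⁻¹ * ∑' x, T x ^ 2) := by field_simp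
    _ ≤ ρ * (ρ * ∑' x, f x ^ 2) := by gcongr
    _ = _ := by ring

open Classical in
theorem walkExp_inv_smul_eq_le (hS : ∀ s ∈ S, s⁻¹ ∈ S) {ρ : ℝ} (hρ : 0 < ρ)
    (h : ∀ f : X → ℝ, f.support.Finite → ∑' x, avgOp S f x * f x ≤ ρ * ∑' x, f x ^ 2)
    (n : ℕ) (x y : X) :
    walkExp S n (fun g => if g⁻¹ • x = y then 1 else 0) ≤ ρ ^ n := by
  set f : X → ℝ := fun z => if z = y then 1 else 0 with hfdef
  have hf : f.support.Finite := (Set.finite_singleton y).subset fun z hz => by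
    by_contra hne
    exact hz (if_neg hne)
  have hfin (m : ℕ) : ((avgOp S)^[m] f).support.Finite := by
    induction m with
    | zero => exact hf
    | succ m ih =>
      rw [Function.iterate_succ_apply']
      exact avgOp_support_finite S ih
  have hnorm (m : ℕ) : ∑' z, (avgOp S)^[m] f z ^ 2 ≤ (ρ ^ m) ^ 2 := by
    induction m with
    | zero => simp [hfdef]
    | succ m ih =>
      rw [Function.iterate_succ_apply']
      calc _ ≤ ρ ^ 2 * ∑' z, (avgOp S)^[m] f z ^ 2 := tsum_avgOp_sq_le hS hρ h (hfin m)
        _ ≤ ρ ^ 2 * (ρ ^ m) ^ 2 := by gcongr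
        _ = _ := by ring
  have e : walkExp S n (fun g => if g⁻¹ • x = y then 1 else 0) = (avgOp S)^[n] f x :=
    walkExp_inv_smul n f x
  rw [e]
  refine (le_abs_self _).trans (abs_le_of_sq_le_sq' ?_ (by positivity) |> fun h => abs_le.2 h)
  refine le_trans ?_ (hnorm n)
  exact (summable_of_support_subset (F := fun z => (avgOp S)^[n] f z ^ 2) (hfin n)
    (by simp_all)).le_tsum x fun _ _ => sq_nonneg _

end Contraction

section Proximal

open Filter Topology

variable {G : Type*} [Group G] {U : Type*}

/-- Translates of operators by elements of a subgroup can be used to move finitely many vectors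
away from the kernels of finitely many operators. -/
def MovesVectors [AddCommGroup U] [Module ℂ U] (ρ : Representation ℂ G U)
    (H : Subgroup G) : Prop :=
  ∀ F : Set (Module.End ℂ U × U), F.Finite → (∀ p ∈ F, p.1 ≠ 0 ∧ p.2 ≠ 0) →
    ∃ h ∈ H, ∀ p ∈ F, p.1 (ρ h⁻¹ p.2) ≠ 0

theorem exists_generic_translates [AddCommGroup U] [Module ℂ U] [FiniteDimensional ℂ U]
    {ρ : Representation ℂ G U} {H : Subgroup G}
    (hmov : MovesVectors ρ H) {P : Bool → Module.End ℂ U} (hP : ∀ b, P b ≠ 0) (K : ℕ) :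
    ∃ h : ℕ → G, (∀ i, h i ∈ H) ∧ ∀ b, ∀ I ⊆ Finset.range K,
      Module.finrank ℂ (⨅ i ∈ I, LinearMap.ker (P b ∘ₗ ρ (h i)⁻¹) : Submodule ℂ U) ≤
        Module.finrank ℂ U - I.card := by
  classical
  induction K with
  | zero =>
    refine ⟨fun _ => 1, fun _ => H.one_mem, fun b I hI => ?_⟩
    obtain rfl : I = ∅ := by simpa using hI
    simpa using Submodule.finrank_le _
  | succ K ih =>
    obtain ⟨h, hH, hI⟩ := ih
    let W (b : Bool) (I : Finset ℕ) : Submodule ℂ U := ⨅ i ∈ I, LinearMap.ker (P b ∘ₗ ρ (h i)⁻¹)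
    let x (q : Bool × Finset ℕ) : U :=
      if hq : ∃ y ∈ W q.1 q.2, y ≠ 0 then hq.choose else 0
    have hx (q) (hq : W q.1 q.2 ≠ ⊥) : x q ∈ W q.1 q.2 ∧ x q ≠ 0 := by
      have hq' := (Submodule.ne_bot_iff _).1 hq
      simp only [x, dif_pos hq']
      exact hq'.choose_spec
    let Q : Finset (Bool × Finset ℕ) :=
      (Finset.univ ×ˢ (Finset.range K).powerset).filter fun q => W q.1 q.2 ≠ ⊥
    obtain ⟨k, hkH, hk⟩ := hmov ((fun q => (P q.1, x q)) '' (Q : Set (Bool × Finset ℕ)))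
      (Q.finite_toSet.image _) (by
        rintro _ ⟨q, hq, rfl⟩
        exact ⟨hP _, (hx q (Finset.mem_filter.1 hq).2).2⟩)
    refine ⟨Function.update h K k, fun i => ?_, fun b I hIK => ?_⟩
    · by_cases hi : i = K
      · subst hi; simpa using hkH
      · rw [Function.update_of_ne hi]; exact hH i
    have hcongr (J : Finset ℕ) (hJ : J ⊆ Finset.range K) :
        (⨅ i ∈ J, LinearMap.ker (P b ∘ₗ ρ (Function.update h K k i)⁻¹)) = W b J := by
      refine iInf_congr fun i => iInf_congr fun hi => ?_
      rw [Function.update_of_ne (Finset.mem_range.1 (hJ hi)).ne]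
    by_cases hKI : K ∈ I
    · set J := I.erase K with hJ
      have hJK : J ⊆ Finset.range K := fun i hi => by
        obtain ⟨h1, h2⟩ := Finset.mem_erase.1 hi
        have := Finset.mem_range.1 (hIK h2)
        exact Finset.mem_range.2 (by omega)
      have hIJ : I = insert K J := (Finset.insert_erase hKI).symm
      have hcard : I.card = J.card + 1 := by
        rw [hIJ, Finset.card_insert_of_notMem (Finset.notMem_erase K I)]
      rw [hIJ, Finset.iInf_insert, hcongr J hJK, ← hIJ, hcard, Function.update_self]
      by_cases hbot : W b J = ⊥
      · rw [hbot, inf_bot_eq, finrank_bot]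
        exact Nat.zero_le _
      · have hlt : LinearMap.ker (P b ∘ₗ ρ k⁻¹) ⊓ W b J < W b J := by
          refine lt_of_le_of_ne inf_le_right fun he => ?_
          have hq : ((b, J) : Bool × Finset ℕ) ∈ Q := by
            simp only [Q, Finset.mem_filter, Finset.mem_product, Finset.mem_univ, true_and,
              Finset.mem_powerset]
            exact ⟨hJK, hbot⟩
          have h1 := (hx (b, J) hbot).1
          rw [← he] at h1
          exact hk _ ⟨_, hq, rfl⟩ h1.1
        have := Submodule.finrank_lt_finrank_of_lt hlt
        have h2 := hI b J hJK
        change Module.finrank ℂ (W b J) ≤ _ at h2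
        omega
    · have hIK' : I ⊆ Finset.range K := fun i hi => by
        have := Finset.mem_range.1 (hIK hi)
        have h3 : i ≠ K := fun h => hKI (h ▸ hi)
        exact Finset.mem_range.2 (by omega)
      rw [hcongr I hIK']
      exact hI b I hIK'

variable [NormedAddCommGroup U] [NormedSpace ℂ U]

theorem exists_contracting {A B : U →L[ℂ] U} (hBA : B ∘L A = 0) {c : ℕ → ℂ} {t : ℕ → U →L[ℂ] U}
    (ht : Tendsto (fun n => c n • t n) atTop (𝓝 A)) {ε : ℝ} (hε : 0 < ε) :
    ∃ n, ∀ u, ε * ‖u‖ < ‖A u‖ → ‖B (t n u)‖ ≤ ε * ‖t n u‖ := by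
  set η : ℝ := min (ε / 2) (ε ^ 2 / (2 * (‖B‖ + 1))) with hη
  have hηpos : 0 < η := by positivity
  obtain ⟨n, hn⟩ := ((tendsto_iff_norm_sub_tendsto_zero.1 ht).eventually (gt_mem_nhds hηpos)).exists
  refine ⟨n, fun u hu => ?_⟩
  set D := c n • t n - A with hD
  have hDu : ‖D u‖ ≤ η * ‖u‖ := (D.le_opNorm u).trans (by gcongr)
  have hct : c n • t n u = A u + D u := by simp [hD]
  have h1 : ‖A u‖ ≤ ‖c n • t n u‖ + η * ‖u‖ := by
    have : A u = c n • t n u - D u := by rw [hct]; abel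
    rw [this]
    exact (norm_sub_le _ _).trans (by gcongr)
  have hη1 : η ≤ ε / 2 := min_le_left _ _
  have hη2 : (‖B‖ + 1) * η ≤ ε ^ 2 / 2 := by
    have : η ≤ ε ^ 2 / (2 * (‖B‖ + 1)) := min_le_right _ _
    calc (‖B‖ + 1) * η ≤ (‖B‖ + 1) * (ε ^ 2 / (2 * (‖B‖ + 1))) := by gcongr
      _ = _ := by field_simp
  have hu0 : 0 ≤ ‖u‖ := norm_nonneg u
  have h2 : ε / 2 * ‖u‖ < ‖c n • t n u‖ := by nlinarith
  have hBAu : B (A u) = 0 := by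
    have := congrArg (fun f : U →L[ℂ] U => f u) hBA
    simpa using this
  have h3 : ‖B (c n • t n u)‖ ≤ ‖B‖ * (η * ‖u‖) := by
    rw [hct, map_add, hBAu, zero_add]
    exact (B.le_opNorm _).trans (by gcongr)
  have h4 : ‖B (c n • t n u)‖ ≤ ε * ‖c n • t n u‖ := by
    have : ‖B‖ * (η * ‖u‖) ≤ (‖B‖ + 1) * η * ‖u‖ := by nlinarith [mul_nonneg hηpos.le hu0]
    nlinarith
  have hc : 0 < ‖c n‖ := by
    refine norm_pos_iff.2 fun h0 => ?_
    rw [h0, zero_smul, norm_zero] at h2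
    nlinarith
  rw [map_smul, norm_smul, norm_smul] at h4
  nlinarith

variable [FiniteDimensional ℂ U]

/-- A subgroup contains elements whose suitably rescaled images converge to a nonzero
noninvertible operator. -/
def HasProximalSequence (ρ : Representation ℂ G U) (H : Subgroup G) : Prop :=
  ∃ (A B : Module.End ℂ U) (c : ℕ → ℂ) (t : ℕ → G), A ≠ 0 ∧ B ≠ 0 ∧ B * A = 0 ∧ (∀ n, t n ∈ H) ∧
    Tendsto (fun n => c n • LinearMap.toContinuousLinearMap (ρ (t n))) atTop
      (𝓝 (LinearMap.toContinuousLinearMap A))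

theorem exists_sum_sq_le {ρ : Representation ℂ G U} {S : Finset G}
    (hmov : MovesVectors ρ (Subgroup.closure (S : Set G)))
    (hprox : HasProximalSequence ρ (Subgroup.closure (S : Set G))) :
    ∃ M : ℝ, 0 < M ∧ ∀ {X : Type*} [MulAction G X] (v : X → U), (∀ x, v x ≠ 0) →
      (∀ (g : G) x, ∃ c : ℂ, v (g • x) = c • ρ g (v x)) → ∀ f : X → ℝ, f.support.Finite →
        ∑' x, f x ^ 2 ≤ M * ∑ s ∈ S, shiftDist f s := by
  classical
  obtain ⟨A, B, c, t, hA, hB, hBA, htH, ht⟩ := hprox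
  set d := Module.finrank ℂ U with hd
  set K := 2 * d + 1 with hK
  let P : Bool → Module.End ℂ U := fun b => if b then A else B
  have hP : ∀ b, P b ≠ 0 := by rintro (_ | _) <;> simpa [P]
  obtain ⟨h, hH, hgen⟩ := exists_generic_translates hmov hP K
  let N (b : Bool) (ε : ℝ) (i : ℕ) : Set U := {u | ‖P b (ρ (h i)⁻¹ u)‖ ≤ ε * ‖u‖}
  have hsmall (b : Bool) (I : Finset ℕ) (hI : I ∈ (Finset.range K).powerset) (hcard : d ≤ I.card) :
      ∀ᶠ ε in 𝓝[>] (0 : ℝ), ∀ u, u ≠ 0 → ∃ i ∈ I, u ∉ N b ε i := by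
    have hker := hgen b I (Finset.mem_powerset.1 hI)
    rw [Nat.sub_eq_zero_of_le hcard, Nat.le_zero, Submodule.finrank_eq_zero] at hker
    let Φ : U →ₗ[ℂ] (I → U) := LinearMap.pi fun i => P b ∘ₗ ρ (h i)⁻¹
    have hΦ : LinearMap.ker Φ = ⊥ := by
      rw [LinearMap.ker_pi, ← hker, iInf_subtype]
    obtain ⟨L, hL0, hL⟩ := Φ.exists_antilipschitzWith hΦ
    have hL' : (0 : ℝ) < L := hL0
    have hev : Set.Ioo (0 : ℝ) (L : ℝ)⁻¹ ∈ 𝓝[>] (0 : ℝ) := Ioo_mem_nhdsGT (by positivity)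
    filter_upwards [hev] with ε hε u hu
    by_contra! hc
    have h1 : ‖u‖ ≤ L * ‖Φ u‖ := by
      have := hL.le_mul_dist u 0
      simpa [dist_eq_norm] using this
    have h2 : ‖Φ u‖ ≤ ε * ‖u‖ :=
      (pi_norm_le_iff_of_nonneg (by have := hε.1; positivity)).2 fun i => hc i i.2
    have h3 : (0 : ℝ) < ‖u‖ := norm_pos_iff.2 hu
    have h4 : L * ε < 1 := by
      calc L * ε < L * (L : ℝ)⁻¹ := by gcongr; exact hε.2
        _ = 1 := by field_simp
    nlinarith
  have hsmall' : ∀ᶠ ε in 𝓝[>] (0 : ℝ), ∀ b : Bool, ∀ I ∈ (Finset.range K).powerset, d ≤ I.card →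
      ∀ u, u ≠ 0 → ∃ i ∈ I, u ∉ N b ε i := by
    refine eventually_all.2 fun b => (Finset.eventually_all _).2 fun I hI => ?_
    by_cases hc : d ≤ I.card
    · filter_upwards [hsmall b I hI hc] with ε hε _ using hε
    · exact Eventually.of_forall fun _ h => absurd h hc
  obtain ⟨ε, hε, hεpos⟩ := (hsmall'.and self_mem_nhdsWithin).exists
  replace hεpos : 0 < ε := hεpos
  set C : ℝ := 1 + ∑ i ∈ Finset.range K, ‖LinearMap.toContinuousLinearMap (ρ (h i)⁻¹)‖ with hC
  have hCpos : 0 < C := by positivity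
  have hCle (i) (hi : i < K) (u : U) : ‖ρ (h i)⁻¹ u‖ ≤ C * ‖u‖ := by
    refine ((LinearMap.toContinuousLinearMap (ρ (h i)⁻¹)).le_opNorm u).trans ?_
    gcongr
    have := Finset.single_le_sum
      (f := fun i => ‖LinearMap.toContinuousLinearMap (ρ (h i)⁻¹)‖)
      (fun _ _ => norm_nonneg _) (Finset.mem_range.2 hi)
    linarith
  have hBA' : LinearMap.toContinuousLinearMap B ∘L LinearMap.toContinuousLinearMap A = 0 := by
    ext u
    have := congrArg (fun f : Module.End ℂ U => f u) hBA
    simpa using this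
  obtain ⟨n, hn⟩ := exists_contracting hBA' ht (ε := ε / C) (by positivity)
  let τ : Fin K → G := fun i => h i * t n * (h i)⁻¹
  have hτ (i) : τ i ∈ Subgroup.closure (S : Set G) :=
    mul_mem (mul_mem (hH i) (htH n)) (inv_mem (hH i))
  choose M hM0 hM using fun i => exists_shiftDist_le.{_, _} (hτ i)
  refine ⟨8 * K * ∑ i, M i + 1, by have := Finset.sum_nonneg fun i (_ : i ∈ Finset.univ) => hM0 i
                                   positivity, fun v hv hequiv f hf => ?_⟩
  have hpp := sum_sq_le_of_pingpong τ (fun i => {x | v x ∈ N false ε i})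
    (fun i => {x | v x ∈ N true ε i}) (fun i x hx => ?_) (fun x => ?_) hf
  · rw [Fintype.card_fin] at hpp
    have h0 : 0 ≤ ∑ s ∈ S, shiftDist f s := Finset.sum_nonneg fun s _ => shiftDist_nonneg f s
    have h1 : ∑ i, shiftDist f (τ i) ≤ (∑ i, M i) * ∑ s ∈ S, shiftDist f s := by
      rw [Finset.sum_mul]
      exact Finset.sum_le_sum fun i _ => hM i f hf
    have h2 : 8 * (K : ℝ) * ∑ i, shiftDist f (τ i) ≤
        8 * K * ((∑ i, M i) * ∑ s ∈ S, shiftDist f s) := by gcongr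
    nlinarith
  · simp only [Set.mem_ofPred_eq, N, P, not_le, if_true] at hx
    set u := ρ (h i)⁻¹ (v x) with hu
    have h1 : ε / C * ‖u‖ < ‖A u‖ := by
      refine lt_of_le_of_lt ?_ hx
      have := hCle i i.2 (v x)
      calc ε / C * ‖u‖ ≤ ε / C * (C * ‖v x‖) := by gcongr
        _ = ε * ‖v x‖ := by field_simp
    have h2 : ‖B (ρ (t n) u)‖ ≤ ε / C * ‖ρ (t n) u‖ := hn u h1
    obtain ⟨a, ha⟩ := hequiv (τ i) x
    have h3 : ρ (h i)⁻¹ (v (τ i • x)) = a • ρ (t n) u := by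
      rw [ha, map_smul]
      simp only [τ, map_mul, Module.End.mul_apply, ← hu]
      rw [← Module.End.mul_apply, ← map_mul, inv_mul_cancel, map_one, Module.End.one_apply]
    simp only [Set.mem_ofPred_eq, N, P, Bool.false_eq_true, if_false]
    have h4 := hCle i i.2 (v (τ i • x))
    rw [h3] at h4 ⊢
    rw [map_smul, norm_smul]
    rw [norm_smul] at h4
    calc ‖a‖ * ‖B (ρ (t n) u)‖ ≤ ‖a‖ * (ε / C * ‖ρ (t n) u‖) := by gcongr
      _ = ε / C * (‖a‖ * ‖ρ (t n) u‖) := by ring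
      _ ≤ ε / C * (C * ‖v (τ i • x)‖) := by gcongr
      _ = _ := by field_simp
  · have hcount (b : Bool) :
        (∑ i : Fin K, if v x ∈ N b ε i then 1 else 0 : ℝ) ≤ d := by
      rw [Fin.sum_univ_eq_sum_range (fun i => if v x ∈ N b ε i then (1 : ℝ) else 0),
        Finset.sum_boole]
      by_contra! hlt
      obtain ⟨i, hi, hi'⟩ := hε b ((Finset.range K).filter fun i => v x ∈ N b ε i)
        (Finset.mem_powerset.2 (Finset.filter_subset _ _)) (by exact_mod_cast hlt.le) (v x) (hv x)
      exact hi' (Finset.mem_filter.1 hi).2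
    have h1 := hcount false
    have h2 := hcount true
    rw [Finset.sum_add_distrib, Fintype.card_fin]
    simp only [Set.mem_ofPred_eq]
    have h3 : (K : ℝ) = 2 * d + 1 := by rw [hK]; push_cast; ring
    rw [h3]
    linarith

open Classical in
/-- Under an irreducibility and a proximality assumption, the random walk moves any line to any
given line with exponentially small probability. -/
theorem exists_walkExp_line_le {ρ : Representation ℂ G U} {S : Finset G} (hSne : S.Nonempty)
    (hS : ∀ s ∈ S, s⁻¹ ∈ S)
    (hmov : MovesVectors ρ (Subgroup.closure (S : Set G)))
    (hprox : HasProximalSequence ρ (Subgroup.closure (S : Set G))) :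
    ∃ r : ℝ, 0 < r ∧ r < 1 ∧ ∀ x : U, x ≠ 0 → ∀ (h : G) (n : ℕ),
      walkExp S n (fun g => if ∃ c : ℂ, ρ (h * g⁻¹) x = c • x then 1 else 0) ≤ r ^ n := by
  obtain ⟨M, hM, hgap⟩ := exists_sum_sq_le hmov hprox
  have hc : (0 : ℝ) < S.card := by exact_mod_cast hSne.card_pos
  set r : ℝ := max (1 - (2 * M * S.card)⁻¹) (1 / 2) with hr
  have hr0 : 0 < r := lt_max_of_lt_right (by norm_num)
  refine ⟨r, hr0, max_lt (sub_lt_self _ (by positivity)) (by norm_num),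
    fun x hx h n => ?_⟩
  have hinj (g : G) {u : U} (hu : u ≠ 0) : ρ g u ≠ 0 := fun h0 => hu (by
    have := congrArg (ρ g⁻¹) h0
    rwa [map_zero, ← Module.End.mul_apply, ← map_mul, inv_mul_cancel, map_one,
      Module.End.one_apply] at this)
  let Λ : Subgroup G :=
    { carrier := {g | ∃ c : ℂ, ρ g x = c • x}
      one_mem' := ⟨1, by simp⟩
      mul_mem' := by
        rintro a b ⟨c, hc⟩ ⟨c', hc'⟩
        exact ⟨c' * c, by rw [map_mul, Module.End.mul_apply, hc', map_smul, hc, smul_smul]⟩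
      inv_mem' := by
        rintro a ⟨c, hc⟩
        have hc0 : c ≠ 0 := by
          rintro rfl
          exact hinj a hx (by rw [hc, zero_smul])
        refine ⟨c⁻¹, ?_⟩
        have := congrArg (ρ a⁻¹) hc
        rw [map_smul, ← Module.End.mul_apply, ← map_mul, inv_mul_cancel, map_one,
          Module.End.one_apply] at this
        rw [eq_inv_smul_iff₀ hc0]
        exact this.symm }
  have hgap' := hgap (X := G ⧸ Λ) (fun q => ρ q.out x) (fun q => hinj _ hx) (fun g q => by
    have hmem : (g * q.out)⁻¹ * (g • q).out ∈ Λ := by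
      rw [← QuotientGroup.eq, QuotientGroup.out_eq', ← smul_eq_mul, ← MulAction.Quotient.smul_coe,
        QuotientGroup.out_eq']
    obtain ⟨c, hc⟩ := hmem
    refine ⟨c, ?_⟩
    have e : (g • q).out = (g * q.out) * ((g * q.out)⁻¹ * (g • q).out) := by group
    rw [e, map_mul, Module.End.mul_apply, hc, map_smul, map_mul, Module.End.mul_apply])
  have hρ : ∀ f : G ⧸ Λ → ℝ, f.support.Finite →
      ∑' x, avgOp S f x * f x ≤ r * ∑' x, f x ^ 2 := fun f hf => by
    refine (tsum_avgOp_mul_self_le hSne hM hf (hgap' f hf)).trans ?_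
    exact mul_le_mul_of_nonneg_right (le_max_left _ _) (tsum_nonneg fun _ => sq_nonneg _)
  have hle := walkExp_inv_smul_eq_le hS hr0 hρ n ((1 : G) : G ⧸ Λ) ((h⁻¹ : G) : G ⧸ Λ)
  have hiff (g : G) : g⁻¹ • ((1 : G) : G ⧸ Λ) = ((h⁻¹ : G) : G ⧸ Λ) ↔
      ∃ c : ℂ, ρ (h * g⁻¹) x = c • x := by
    rw [MulAction.Quotient.smul_coe, eq_comm, QuotientGroup.eq, inv_inv, smul_eq_mul, mul_one]
    rfl
  refine (walkExp_mono n fun g => ?_).trans hle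
  simp only [hiff]
  split_ifs <;> simp

end Proximal

section Density

/-- The `i`-th factor of an element of `SL₂(ℤ)³`. -/
def factor (i : Fin 3) : GammaSL →* SL2Z :=
  ![MonoidHom.fst _ _, (MonoidHom.fst _ _).comp (MonoidHom.snd _ _),
    (MonoidHom.snd _ _).comp (MonoidHom.snd _ _)] i

theorem entryZ_apply (g : GammaSL) (i : Fin 3) (a b : Fin 2) :
    entryZ g (i, a, b) = (factor i g : Matrix (Fin 2) (Fin 2) ℤ) a b := by
  fin_cases i <;> rfl

/-- The element of `SL₂(ℂ)³` with given factors. -/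
def ofFactors (h : Fin 3 → SL2C) : GammaC := (h 0, h 1, h 2)

theorem entryC_ofFactors (h : Fin 3 → SL2C) (i : Fin 3) (a b : Fin 2) :
    entryC (ofFactors h) (i, a, b) = (h i : Matrix (Fin 2) (Fin 2) ℂ) a b := by
  fin_cases i <;> rfl

theorem exists_ofFactors (h : GammaC) : ∃ k, ofFactors k = h :=
  ⟨![h.1, h.2.1, h.2.2], rfl⟩

/-- A polynomial parametrization of `SL₂`. -/
def slParam {R : Type*} [CommRing R] (t : Fin 4 → R) : Matrix (Fin 2) (Fin 2) R :=
  !![1, t 0; 0, 1] * !![1, 0; t 1, 1] * !![1, t 2; 0, 1] * !![1, 0; t 3, 1]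

theorem slParam_eq {R : Type*} [CommRing R] (t : Fin 4 → R) : slParam t =
    !![1 + t 0 * t 1 + ((1 + t 0 * t 1) * t 2 + t 0) * t 3, (1 + t 0 * t 1) * t 2 + t 0;
      t 1 + (t 1 * t 2 + 1) * t 3, t 1 * t 2 + 1] := by
  simp [slParam]

theorem det_slParam {R : Type*} [CommRing R] (t : Fin 4 → R) : (slParam t).det = 1 := by
  rw [slParam_eq, Matrix.det_fin_two_of]
  ring

theorem exists_slParam_eq {K : Type*} [Field K] (g : Matrix.SpecialLinearGroup (Fin 2) K) :
    ∃ t, slParam t = (g : Matrix (Fin 2) (Fin 2) K) := by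
  obtain ⟨M, hM⟩ := g
  rw [Matrix.det_fin_two] at hM
  by_cases hc : M 1 0 = 0
  · have hd : M 1 1 ≠ 0 := by
      rintro hd
      simp [hc, hd] at hM
    refine ⟨![(M 0 0 + M 0 1 - 1) / M 1 1, M 1 1, (M 1 1 - 1) / M 1 1, -1], ?_⟩
    rw [slParam_eq]
    ext i j
    fin_cases i <;> fin_cases j <;> simp <;> field_simp
    · linear_combination -hM - M 0 1 * hc
    · linear_combination hM + M 0 1 * hc
    · rw [hc]; ring
    · ring
  · refine ⟨![(M 0 0 - 1) / M 1 0, M 1 0, (M 1 1 - 1) / M 1 0, 0], ?_⟩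
    rw [slParam_eq]
    ext i j
    fin_cases i <;> fin_cases j <;> simp <;> field_simp
    · ring
    · linear_combination hM
    · ring

theorem slParam_map {R R' : Type*} [CommRing R] [CommRing R'] (f : R →+* R') (t : Fin 4 → R) :
    slParam (fun k => f (t k)) = (slParam t).map f := by
  rw [slParam_eq, slParam_eq]
  ext i j
  fin_cases i <;> fin_cases j <;> simp

open MvPolynomial

theorem aeval_sum_monomial {σ : Type*} [Fintype σ] (θ : ℂ →ₗ[ℚ] ℚ) (q : MvPolynomial σ ℂ)
    (r : σ → ℚ) :
    aeval (fun x => (r x : ℂ)) (∑ m ∈ q.support, monomial m (θ (coeff m q))) =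
      ((θ (eval (fun x => (r x : ℂ)) q) : ℚ) : ℂ) := by
  rw [eval_eq', map_sum, map_sum, Rat.cast_sum]
  refine Finset.sum_congr rfl fun m _ => ?_
  have : coeff m q * ∏ i, (r i : ℂ) ^ m i = (∏ i, r i ^ m i) • coeff m q := by
    rw [Rat.smul_def, mul_comm]
    push_cast
    rfl
  rw [this, map_smul, aeval_monomial, Finsupp.prod_fintype _ _ (by simp)]
  simp [mul_comm]

theorem eval_slParam_eq_zero {H : Subgroup GammaSL} (hd : ZariskiDense H)
    {q : MvPolynomial (Fin 3 × Fin 2 × Fin 2) ℂ}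
    (hq : ∀ g ∈ H, eval (fun x => (entryZ g x : ℂ)) q = 0) (t : Fin 3 × Fin 4 → ℚ) :
    eval (fun x => slParam (fun k => (t (x.1, k) : ℂ)) x.2.1 x.2.2) q = 0 := by
  have hmap (i : Fin 3) : slParam (fun k => (t (i, k) : ℂ)) =
      (slParam fun k => t (i, k)).map (algebraMap ℚ ℂ) := slParam_map (algebraMap ℚ ℂ) _
  rw [← Module.forall_dual_apply_eq_zero_iff ℚ]
  intro θ
  let k : Fin 3 → SL2C := fun i => ⟨slParam fun k => (t (i, k) : ℂ), det_slParam _⟩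
  have h := hd (∑ m ∈ q.support, monomial m (θ (coeff m q))) (fun g hg => by
    have := aeval_sum_monomial θ q fun x => (entryZ g x : ℚ)
    simp only [Rat.cast_intCast] at this
    rw [this, hq g hg]
    simp) (ofFactors k)
  have hk (i : Fin 3) (a b : Fin 2) : (k i : Matrix (Fin 2) (Fin 2) ℂ) a b =
      slParam (fun k => (t (i, k) : ℂ)) a b := rfl
  have e : entryC (ofFactors k) =
      fun x => ((slParam (fun k => t (x.1, k)) x.2.1 x.2.2 : ℚ) : ℂ) := by
    ext ⟨i, a, b⟩
    rw [entryC_ofFactors, hk]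
    exact congrFun (congrFun (hmap i) a) b
  rw [e, aeval_sum_monomial] at h
  simp only [hmap]
  exact_mod_cast h

/-- A Zariski-dense subgroup contains an element at which finitely many polynomials, none of which
vanishes identically on `SL₂(ℂ)³`, are simultaneously nonzero. -/
theorem ZariskiDense.exists_eval_ne_zero {H : Subgroup GammaSL} (hd : ZariskiDense H)
    {ι : Type*} [Finite ι] (p : ι → MvPolynomial (Fin 3 × Fin 2 × Fin 2) ℂ)
    (hp : ∀ i, ∃ h : GammaC, eval (entryC h) (p i) ≠ 0) :
    ∃ g ∈ H, ∀ i, eval (fun x => (entryZ g x : ℂ)) (p i) ≠ 0 := by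
  classical
  have := Fintype.ofFinite ι
  by_contra! hcon
  have hq : ∀ g ∈ H, eval (fun x => (entryZ g x : ℂ)) (∏ i, p i) = 0 := fun g hg => by
    obtain ⟨i, hi⟩ := hcon g hg
    rw [map_prod]
    exact Finset.prod_eq_zero (Finset.mem_univ i) hi
  let Ψ : Fin 3 × Fin 2 × Fin 2 → MvPolynomial (Fin 3 × Fin 4) ℂ :=
    fun x => slParam (fun k => X (x.1, k)) x.2.1 x.2.2
  have hΨ (t : Fin 3 × Fin 4 → ℂ) (r : MvPolynomial (Fin 3 × Fin 2 × Fin 2) ℂ) :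
      eval t (bind₁ Ψ r) = eval (fun x => slParam (fun k => t (x.1, k)) x.2.1 x.2.2) r := by
    rw [eval, eval₂Hom_bind₁]
    congr 2
    ext x
    have := slParam_map (eval t) fun k => (X (x.1, k) : MvPolynomial (Fin 3 × Fin 4) ℂ)
    simp only [eval_X] at this
    rw [this]
    rfl
  have hzero : bind₁ Ψ (∏ i, p i) = 0 := by
    refine funext_set (fun _ => Set.range ((↑) : ℚ → ℂ))
      (fun _ => Set.infinite_range_of_injective Rat.cast_injective) fun t ht => ?_
    choose t' ht' using fun j => ht j (Set.mem_univ j)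
    obtain rfl : (fun j => (t' j : ℂ)) = t := _root_.funext ht'
    rw [hΨ, map_zero]
    exact eval_slParam_eq_zero hd hq t'
  rw [map_prod, Finset.prod_eq_zero_iff] at hzero
  obtain ⟨i, _, hi⟩ := hzero
  obtain ⟨h, hh⟩ := hp i
  obtain ⟨k, rfl⟩ := exists_ofFactors h
  choose t ht using fun i => exists_slParam_eq (k i)
  apply hh
  have := hΨ (fun j => t j.1 j.2) (p i)
  rw [hi, map_zero] at this
  rw [this]
  congr 2
  ext ⟨i, a, b⟩
  rw [entryC_ofFactors, ← ht]

end Density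

section Representations

/-- The `i`-th factor of an element of `SL₂(ℤ)³`, as a complex matrix. -/
def complexFactor (i : Fin 3) : GammaSL →* Matrix (Fin 2) (Fin 2) ℂ where
  toFun g := (factor i g : Matrix (Fin 2) (Fin 2) ℤ).map (Int.castRingHom ℂ)
  map_one' := by simp
  map_mul' g h := by
    rw [map_mul, ← Matrix.map_mul]
    rfl

theorem complexFactor_apply (i : Fin 3) (g : GammaSL) (a b : Fin 2) :
    complexFactor i g a b = entryZ g (i, a, b) := by
  rw [entryZ_apply]
  rfl

theorem det_complexFactor (i : Fin 3) (g : GammaSL) : (complexFactor i g).det = 1 := by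
  change ((factor i g : Matrix (Fin 2) (Fin 2) ℤ).map (Int.castRingHom ℂ)).det = 1
  rw [← RingHom.mapMatrix_apply, ← RingHom.map_det]
  exact (congrArg _ (factor i g).2).trans (map_one _)

theorem complexFactor_inv (i : Fin 3) (g : GammaSL) :
    complexFactor i g⁻¹ = (complexFactor i g).adjugate := by
  have h : complexFactor i g⁻¹ * complexFactor i g = 1 := by
    rw [← map_mul, inv_mul_cancel, map_one]
  have hadj := congrArg (· * (complexFactor i g).adjugate) h
  simpa only [mul_assoc, Matrix.mul_adjugate, det_complexFactor, one_smul, mul_one, one_mul]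
    using hadj

/-- A linear form on `2 × 2` matrices vanishing on `SL₂` is zero. -/
theorem linearForm_eq_zero {φ : Module.Dual ℂ (Matrix (Fin 2) (Fin 2) ℂ)}
    (h : ∀ g : SL2C, φ (g : Matrix (Fin 2) (Fin 2) ℂ) = 0) : φ = 0 := by
  have hM (M : Matrix (Fin 2) (Fin 2) ℂ) (hM : M.det = 1) : φ M = 0 := h ⟨M, hM⟩
  have h1 := hM 1 (by simp)
  have h2 := hM !![1, 1; 0, 1] (by simp)
  have h3 := hM !![1, 0; 1, 1] (by simp)
  have h4 := hM !![2, 1; 1, 1] (by rw [det_fin_two_of]; norm_num)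
  refine LinearMap.ext fun M => ?_
  have e : M = (M 0 0 - M 0 1 - M 1 0) • (1 : Matrix (Fin 2) (Fin 2) ℂ) +
      (M 0 1 - M 0 0 + M 1 1) • !![1, 1; 0, 1] + (M 1 0 - M 0 0 + M 1 1) • !![1, 0; 1, 1] +
      (M 0 0 - M 1 1) • !![2, 1; 1, 1] := by
    ext a b
    fin_cases a <;> fin_cases b <;> simp <;> ring
  rw [e]
  simp only [map_add, map_smul, h1, h2, h3, h4, smul_zero, add_zero, LinearMap.zero_apply]

open MvPolynomial in
/-- A Zariski-dense subgroup contains an element at which given nonzero bilinear forms in two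
distinct factors are nonzero. -/
theorem ZariskiDense.exists_bilin_ne_zero {H : Subgroup GammaSL} (hd : ZariskiDense H)
    {i j : Fin 3} (hij : i ≠ j) {ι : Type*} [Finite ι]
    (ψ : ι → Matrix (Fin 2) (Fin 2) ℂ →ₗ[ℂ] Module.Dual ℂ (Matrix (Fin 2) (Fin 2) ℂ))
    (hψ : ∀ k, ψ k ≠ 0) :
    ∃ h ∈ H, ∀ k, ψ k (complexFactor i h⁻¹) (complexFactor j h) ≠ 0 := by
  let Y (i : Fin 3) : Matrix (Fin 2) (Fin 2) (MvPolynomial (Fin 3 × Fin 2 × Fin 2) ℂ) :=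
    Matrix.of fun a b => X (i, a, b)
  let p (k : ι) : MvPolynomial (Fin 3 × Fin 2 × Fin 2) ℂ :=
    ∑ a, ∑ b, ∑ c, ∑ d, C (ψ k (single a b 1) (single c d 1)) *
      (Y i).adjugate a b * Y j c d
  have hp (k : ι) (f : Fin 3 × Fin 2 × Fin 2 → ℂ) :
      eval f (p k) = ψ k (Matrix.of fun a b => f (i, a, b)).adjugate
        (Matrix.of fun a b => f (j, a, b)) := by
    have e1 (i : Fin 3) : (Y i).map (eval f) = Matrix.of fun a b => f (i, a, b) := by
      ext a b
      simp [Y]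
    rw [← e1, ← e1, ← RingHom.mapMatrix_apply, ← RingHom.mapMatrix_apply, ← RingHom.map_adjugate]
    have e2 (A : Matrix (Fin 2) (Fin 2) ℂ) : A = ∑ a, ∑ b, A a b • single a b 1 := by
      simpa using matrix_eq_sum_single A
    rw [e2 ((eval f).mapMatrix (Y i).adjugate), e2 ((eval f).mapMatrix (Y j))]
    simp only [p, map_add, map_mul, eval_C, LinearMap.add_apply, RingHom.mapMatrix_apply, map_apply,
      map_smul, LinearMap.smul_apply, smul_eq_mul, Fin.sum_univ_two]
    ring
  obtain ⟨h, hh, hne⟩ := hd.exists_eval_ne_zero p fun k => by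
    have h1 : ∃ M : SL2C, ψ k (M : Matrix (Fin 2) (Fin 2) ℂ) ≠ 0 := by
      by_contra! hcon
      refine hψ k (LinearMap.ext fun M => LinearMap.ext fun N => ?_)
      have := linearForm_eq_zero (φ := (ψ k).flip N) fun g => by
        rw [LinearMap.flip_apply, hcon, LinearMap.zero_apply]
      rw [← LinearMap.flip_apply, this]
      rfl
    obtain ⟨M, hM⟩ := h1
    have h2 : ∃ N : SL2C,
        ψ k (M : Matrix (Fin 2) (Fin 2) ℂ) (N : Matrix (Fin 2) (Fin 2) ℂ) ≠ 0 := by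
      by_contra! hcon
      exact hM (linearForm_eq_zero hcon)
    obtain ⟨N, hN⟩ := h2
    refine ⟨ofFactors fun l => if l = i then M⁻¹ else N, ?_⟩
    rw [hp]
    simp only [entryC_ofFactors, if_neg hij.symm, if_true]
    convert hN
    · exact congrArg Subtype.val (inv_inv M)
    · rfl
  refine ⟨h, hh, fun k => ?_⟩
  have := hne k
  rw [hp] at this
  have e (i : Fin 3) : (Matrix.of fun a b => ((entryZ h (i, a, b) : ℤ) : ℂ)) =
      complexFactor i h := by
    ext a b
    rw [complexFactor_apply]
    rfl
  rwa [e, e, ← complexFactor_inv] at this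

/-- A Zariski-dense subgroup contains an element which is hyperbolic in each factor. -/
theorem ZariskiDense.exists_hyperbolic {H : Subgroup GammaSL} (hd : ZariskiDense H) :
    ∃ γ ∈ H, ∀ i, ∃ t : ℤ, 2 < |t| ∧ (complexFactor i γ).trace = t := by
  obtain ⟨γ, hγ, h⟩ := hd.exists_eval_ne_zero (ι := Fin 3 × Finset.Icc (-2 : ℤ) 2)
    (fun k => MvPolynomial.X (k.1, 0, 0) + MvPolynomial.X (k.1, 1, 1) -
      MvPolynomial.C ((k.2 : ℤ) : ℂ)) fun k => by
    let M : SL2C := ⟨!![2, 1; 1, 1], by rw [det_fin_two_of]; norm_num⟩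
    refine ⟨ofFactors fun _ => M, ?_⟩
    simp only [map_sub, map_add, MvPolynomial.eval_X, MvPolynomial.eval_C, entryC_ofFactors]
    have := (Finset.mem_Icc.1 k.2.2).2
    change (2 : ℂ) + 1 - ((k.2 : ℤ) : ℂ) ≠ 0
    intro h0
    have : ((k.2 : ℤ) : ℂ) = ((3 : ℤ) : ℂ) := by push_cast; linear_combination -h0
    have := Int.cast_injective this
    omega
  refine ⟨γ, hγ, fun i => ⟨entryZ γ (i, 0, 0) + entryZ γ (i, 1, 1), ?_, ?_⟩⟩
  · by_contra! hle
    have hmem := Finset.mem_Icc.2 (abs_le.1 hle)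
    refine h (i, ⟨_, hmem⟩) ?_
    simp
  · rw [trace_fin_two, complexFactor_apply, complexFactor_apply]
    push_cast
    rfl

theorem exists_norm_gt_one {t : ℤ} (ht : 2 < |t|) : ∃ l : ℂ, 1 < ‖l‖ ∧ l + l⁻¹ = t := by
  obtain ⟨l, hl⟩ := IsAlgClosed.exists_eval₂_eq_zero (RingHom.id ℂ)
    (Polynomial.X ^ 2 - Polynomial.C (t : ℂ) * Polynomial.X + 1) (by
      have : (Polynomial.X ^ 2 - Polynomial.C (t : ℂ) * Polynomial.X + 1).degree = 2 := by
        compute_degree!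
      rw [this]; decide)
  simp only [Polynomial.eval₂_id, Polynomial.eval_add, Polynomial.eval_sub, Polynomial.eval_pow,
    Polynomial.eval_X, Polynomial.eval_mul, Polynomial.eval_C, Polynomial.eval_one] at hl
  have hl0 : l ≠ 0 := by
    rintro rfl
    simp at hl
  have hsum : l + l⁻¹ = t := by
    field_simp
    linear_combination hl
  rcases lt_trichotomy ‖l‖ 1 with h | h | h
  · refine ⟨l⁻¹, ?_, by rw [inv_inv, add_comm, hsum]⟩
    rw [norm_inv]
    exact (one_lt_inv₀ (norm_pos_iff.2 hl0)).2 h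
  · exfalso
    have h1 := norm_add_le l l⁻¹
    rw [hsum, norm_inv, h, Complex.norm_intCast] at h1
    have : (2 : ℝ) < |(t : ℝ)| := by exact_mod_cast ht
    norm_num at h1
    linarith
  · exact ⟨l, h, hsum⟩

/-- Spectral decomposition of a hyperbolic matrix. -/
theorem exists_spectral {g : Matrix (Fin 2) (Fin 2) ℂ} (hg : g.det = 1) {t : ℤ} (ht : 2 < |t|)
    (htr : g.trace = t) :
    ∃ (l : ℂ) (p q : Matrix (Fin 2) (Fin 2) ℂ), 1 < ‖l‖ ∧ p ≠ 0 ∧ q ≠ 0 ∧ q * p = 0 ∧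
      (∀ n : ℕ, g ^ n = l ^ n • p + l⁻¹ ^ n • q) ∧
      ∀ n : ℕ, g.adjugate ^ n = l⁻¹ ^ n • p + l ^ n • q := by
  obtain ⟨l, hl, hsum⟩ := exists_norm_gt_one ht
  have hl0 : l ≠ 0 := by
    rintro rfl
    simp at hl
    linarith
  have hne : l ^ 2 ≠ 1 := fun h => by
    have := congrArg norm h
    rw [norm_pow, norm_one] at this
    nlinarith
  have hsub : l - l⁻¹ ≠ 0 := fun h => hne (by
    field_simp at h
    linear_combination h)
  have hsq : g * g = (l + l⁻¹) • g - 1 := by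
    rw [hsum, ← htr]
    rw [det_fin_two] at hg
    ext a b
    fin_cases a <;> fin_cases b <;> simp [mul_apply, trace_fin_two] <;>
      first | linear_combination -hg | ring
  have hadj : g.adjugate = (l + l⁻¹) • (1 : Matrix (Fin 2) (Fin 2) ℂ) - g := by
    rw [hsum, ← htr, adjugate_fin_two]
    ext a b
    fin_cases a <;> fin_cases b <;> simp [trace_fin_two]
  set c := (l - l⁻¹)⁻¹ with hc
  have hc0 : c ≠ 0 := inv_ne_zero hsub
  have hc1 : c * (l - l⁻¹) = 1 := inv_mul_cancel₀ hsub
  have hli : l * l⁻¹ = 1 := mul_inv_cancel₀ hl0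
  set m := l⁻¹ with hm
  have hdet (z : ℂ) (hz : z ^ 2 ≠ 1) : g - z • 1 ≠ 0 := fun h => hz (by
    rw [sub_eq_zero.1 h] at hg
    simpa [det_fin_two, sq] using hg)
  have hgp : g * (g - m • 1) = l • (g - m • 1) := by
    rw [mul_sub, hsq, mul_smul_comm, mul_one, smul_sub, smul_smul, hli]
    module
  have hgq : g * (l • 1 - g) = m • (l • 1 - g) := by
    rw [mul_sub, hsq, mul_smul_comm, mul_one, smul_sub, smul_smul, mul_comm m, hli]
    module
  have hap : g.adjugate * (g - m • 1) = m • (g - m • 1) := by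
    rw [hadj, sub_mul, hgp, smul_mul_assoc, one_mul]
    module
  have haq : g.adjugate * (l • 1 - g) = l • (l • 1 - g) := by
    rw [hadj, sub_mul, hgq, smul_mul_assoc, one_mul]
    module
  have hone : c • (g - m • 1) + c • (l • 1 - g) = 1 := by
    rw [← smul_add, show g - m • (1 : Matrix (Fin 2) (Fin 2) ℂ) + (l • 1 - g) = (l - m) • 1 by
      module, smul_smul, hc1, one_smul]
  refine ⟨l, c • (g - m • 1), c • (l • 1 - g), hl, smul_ne_zero hc0 (hdet m ?_),
    smul_ne_zero hc0 ?_, ?_, fun n => ?_, fun n => ?_⟩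
  · intro h
    apply hne
    calc l ^ 2 = l ^ 2 * m ^ 2 := by rw [h, mul_one]
      _ = (l * m) ^ 2 := by ring
      _ = 1 := by rw [hli, one_pow]
  · rw [← neg_sub, neg_ne_zero]
    exact hdet l hne
  · rw [smul_mul_smul_comm, sub_mul, smul_mul_assoc, one_mul, hgp, sub_self, smul_zero]
  · induction n with
    | zero => simpa using hone.symm
    | succ n ih =>
      rw [pow_succ', ih, mul_add, mul_smul_comm, mul_smul_comm, mul_smul_comm, mul_smul_comm,
        hgp, hgq]
      module
  · induction n with
    | zero => simpa using hone.symm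
    | succ n ih =>
      rw [pow_succ', ih, mul_add, mul_smul_comm, mul_smul_comm, mul_smul_comm, mul_smul_comm,
        hap, haq]
      module

/-- The representation of `SL₂(ℤ)³` on `ℂ²` through the `i`-th factor. -/
noncomputable def stdRep (i : Fin 3) : Representation ℂ GammaSL (Fin 2 → ℂ) :=
  (Matrix.toLinAlgEquiv' : Matrix (Fin 2) (Fin 2) ℂ ≃ₐ[ℂ] _).toAlgHom.toMonoidHom.comp
    (complexFactor i)

/-- The representation of `SL₂(ℤ)³` on `2 × 2` matrices, the `i`-th factor acting by left
multiplication, and the `j`-th by right multiplication. -/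
noncomputable def homRep (i j : Fin 3) : Representation ℂ GammaSL (Matrix (Fin 2) (Fin 2) ℂ) where
  toFun g := LinearMap.mulLeft ℂ (complexFactor i g) ∘ₗ LinearMap.mulRight ℂ (complexFactor j g⁻¹)
  map_one' := by ext; simp
  map_mul' g h := by
    refine LinearMap.ext fun x => ?_
    simp [mul_assoc]

theorem homRep_apply (i j : Fin 3) (g : GammaSL) (x : Matrix (Fin 2) (Fin 2) ℂ) :
    homRep i j g x = complexFactor i g * (x * complexFactor j g⁻¹) := rfl

end Representations

section RepresentationProperties

open Filter Topology

variable {H : Subgroup GammaSL}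

theorem movesVectors_stdRep (hd : ZariskiDense H) (i : Fin 3) : MovesVectors (stdRep i) H := by
  intro F hF hne
  obtain ⟨j, hij⟩ := exists_ne i
  have := hF.to_subtype
  have key (p : F) : ∃ k : Fin 2,
      ((LinearMap.mul ℂ ℂ).compl₁₂
        (LinearMap.proj k ∘ₗ p.1.1 ∘ₗ (Matrix.mulVecBilin ℂ ℂ).flip p.1.2)
        (Matrix.entryLinearMap ℂ ℂ (0 : Fin 2) (0 : Fin 2))) ≠ 0 := by
    obtain ⟨hP, hx⟩ := hne p.1 p.2
    obtain ⟨v, hv⟩ := DFunLike.ne_iff.1 hP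
    obtain ⟨k, hk⟩ := Function.ne_iff.1 hv
    obtain ⟨m, hm⟩ := Function.ne_iff.1 hx
    refine ⟨k, fun h0 => hk ?_⟩
    have h1 := LinearMap.congr_fun₂ h0 (vecMulVec v (Pi.single m (p.1.2 m)⁻¹)) 1
    have h2 : vecMulVec v (Pi.single m (p.1.2 m)⁻¹) *ᵥ p.1.2 = v := by
      rw [vecMulVec_mulVec, single_dotProduct, inv_mul_cancel₀ hm]
      simp
    simpa [-mulVec_fin_two, h2] using h1
  choose k hk using key
  obtain ⟨h, hh, hψ⟩ := hd.exists_bilin_ne_zero hij.symm _ hk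
  refine ⟨h, hh, fun p hp h0 => hψ ⟨p, hp⟩ ?_⟩
  have h0 : p.1 (complexFactor i h⁻¹ *ᵥ p.2) = 0 := h0
  simp [-mulVec_fin_two, h0]

theorem movesVectors_homRep (hd : ZariskiDense H) {i j : Fin 3} (hij : i ≠ j) :
    MovesVectors (homRep i j) H := by
  intro F hF hne
  have := hF.to_subtype
  have key (p : F) : ∃ φ : Module.Dual ℂ (Matrix (Fin 2) (Fin 2) ℂ),
      ((LinearMap.mul ℂ (Matrix (Fin 2) (Fin 2) ℂ) ∘ₗ LinearMap.mulRight ℂ p.1.2).compr₂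
        (φ ∘ₗ p.1.1)) ≠ 0 := by
    obtain ⟨hP, hx⟩ := hne p.1 p.2
    have hx : ∃ k l, p.1.2 k l ≠ 0 := by
      by_contra! hcon
      exact hx (Matrix.ext hcon)
    obtain ⟨k, l, hkl⟩ := hx
    by_contra! hcon
    refine hP (Matrix.ext_linearMap ℂ fun a b => LinearMap.ext fun c => ?_)
    rw [LinearMap.zero_comp, LinearMap.zero_apply, ← Module.forall_dual_apply_eq_zero_iff ℂ]
    intro φ
    have h1 := LinearMap.congr_fun₂ (hcon φ) (single a k c) (single l b (p.1.2 k l)⁻¹)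
    have h2 : single a k c * p.1.2 * single l b (p.1.2 k l)⁻¹ = single a b c := by
      rw [single_mul_mul_single, mul_assoc, mul_inv_cancel₀ hkl, mul_one]
    simpa [h2] using h1
  choose k hk using key
  obtain ⟨h, hh, hψ⟩ := hd.exists_bilin_ne_zero hij _ hk
  refine ⟨h, hh, fun p hp h0 => hψ ⟨p, hp⟩ ?_⟩
  have h0 : p.1 (complexFactor i h⁻¹ * (p.2 * complexFactor j h⁻¹⁻¹)) = 0 := h0
  rw [inv_inv, ← mul_assoc] at h0
  simp [h0]

theorem tendsto_inv_pow_sq {l : ℂ} (hl : 1 < ‖l‖) :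
    Tendsto (fun n : ℕ => (l⁻¹ ^ n) ^ 2) atTop (𝓝 0) := by
  simpa [pow_right_comm] using (tendsto_pow_atTop_nhds_zero_of_norm_lt_one (x := l⁻¹) (by
    rw [norm_inv]
    exact inv_lt_one_of_one_lt₀ hl)).pow 2

theorem hasProximalSequence_of_eq {G U : Type*} [Group G] [NormedAddCommGroup U] [NormedSpace ℂ U]
    [FiniteDimensional ℂ U] {ρ : Representation ℂ G U} {H : Subgroup G} {A B : Module.End ℂ U}
    (hA : A ≠ 0) (hB : B ≠ 0) (hBA : ∀ x, B (A x) = 0) {γ : G} (hγ : γ ∈ H) {c : ℕ → ℂ} {ι : Type*}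
    [Fintype ι] {a : ι → ℕ → ℂ} {T : ι → Module.End ℂ U} (ha : ∀ k, Tendsto (a k) atTop (𝓝 0))
    (h : ∀ n x, c n • ρ (γ ^ n) x = A x + ∑ k, a k n • T k x) : HasProximalSequence ρ H := by
  refine ⟨A, B, c, fun n => γ ^ n, hA, hB, LinearMap.ext hBA, fun n => pow_mem hγ n, ?_⟩
  have hrep (n : ℕ) : c n • ρ (γ ^ n) = A + ∑ k, a k n • T k :=
    LinearMap.ext fun x => by simpa using h n x
  simp only [← map_smul, hrep, map_add, map_sum]
  simpa using (tendsto_const_nhds (x := LinearMap.toContinuousLinearMap A)).add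
    (tendsto_finsetSum Finset.univ fun k _ =>
      (ha k).smul_const (LinearMap.toContinuousLinearMap (T k)))

theorem hasProximalSequence_stdRep (hd : ZariskiDense H) (i : Fin 3) :
    HasProximalSequence (stdRep i) H := by
  obtain ⟨γ, hγ, h⟩ := hd.exists_hyperbolic
  obtain ⟨t, ht, htr⟩ := h i
  obtain ⟨l, p, q, hl, hp, hq, hqp, hpow, -⟩ := exists_spectral (det_complexFactor i γ) ht htr
  let e := (Matrix.toLinAlgEquiv' : Matrix (Fin 2) (Fin 2) ℂ ≃ₐ[ℂ] _)
  have hl0 : l ≠ 0 := norm_pos_iff.1 (by linarith)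
  refine hasProximalSequence_of_eq (A := e p) (B := e q) (c := fun n => l⁻¹ ^ n) (ι := Fin 1)
    (a := fun _ n => (l⁻¹ ^ n) ^ 2) (T := fun _ => e q) (by simpa) (by simpa) (fun x => ?_) hγ
    (fun _ => tendsto_inv_pow_sq hl) fun n x => ?_
  · rw [← Module.End.mul_apply, ← map_mul, hqp, map_zero, LinearMap.zero_apply]
  · have h1 : stdRep i (γ ^ n) = e (complexFactor i γ ^ n) := by
      rw [← map_pow]
      rfl
    rw [h1, hpow, ← LinearMap.smul_apply, map_add, map_smul, map_smul, smul_add, smul_smul,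
      smul_smul, ← mul_pow, inv_mul_cancel₀ hl0, one_pow, one_smul]
    simp [sq]

attribute [local instance] Matrix.normedAddCommGroup Matrix.normedSpace

theorem hasProximalSequence_homRep (hd : ZariskiDense H) (i j : Fin 3) :
    HasProximalSequence (homRep i j) H := by
  obtain ⟨γ, hγ, h⟩ := hd.exists_hyperbolic
  obtain ⟨t, ht, htr⟩ := h i
  obtain ⟨t', ht', htr'⟩ := h j
  obtain ⟨l, p, q, hl, hp, hq, hqp, hpow, -⟩ := exists_spectral (det_complexFactor i γ) ht htr
  obtain ⟨m, p', q', hm, hp', hq', hqp', -, hpow'⟩ :=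
    exists_spectral (det_complexFactor j γ) ht' htr'
  have hl0 : l ≠ 0 := norm_pos_iff.1 (by linarith)
  have hm0 : m ≠ 0 := norm_pos_iff.1 (by linarith)
  let e (a b : Matrix (Fin 2) (Fin 2) ℂ) : Module.End ℂ (Matrix (Fin 2) (Fin 2) ℂ) :=
    LinearMap.mulLeft ℂ a ∘ₗ LinearMap.mulRight ℂ b
  have he (a b x) : e a b x = a * (x * b) := rfl
  have he0 {a b} (ha : a ≠ 0) (hb : b ≠ 0) : e a b ≠ 0 := by
    have ha' : ∃ k l, a k l ≠ 0 := by
      by_contra! hcon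
      exact ha (Matrix.ext hcon)
    have hb' : ∃ k l, b k l ≠ 0 := by
      by_contra! hcon
      exact hb (Matrix.ext hcon)
    obtain ⟨k, l, hkl⟩ := ha'
    obtain ⟨r, s, hrs⟩ := hb'
    intro h0
    have := congrFun (congrFun (LinearMap.congr_fun h0 (single l r 1)) k) s
    rw [he] at this
    simp [Matrix.mul_apply, single_apply, ite_and, hkl, hrs] at this
  refine hasProximalSequence_of_eq (A := e p q') (B := e q 1) (c := fun n => l⁻¹ ^ n * m⁻¹ ^ n)
    (a := ![fun n => (m⁻¹ ^ n) ^ 2, fun n => (l⁻¹ ^ n) ^ 2,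
      fun n => (l⁻¹ ^ n) ^ 2 * (m⁻¹ ^ n) ^ 2])
    (T := ![e p p', e q q', e q p']) (he0 hp hq') (he0 hq one_ne_zero) (fun x => ?_) hγ
    (fun k => ?_) fun n x => ?_
  · rw [he, he, mul_one, ← mul_assoc, hqp, zero_mul]
  · fin_cases k
    · exact tendsto_inv_pow_sq hm
    · exact tendsto_inv_pow_sq hl
    · simpa using (tendsto_inv_pow_sq hl).mul (tendsto_inv_pow_sq hm)
  · have hln : l⁻¹ ^ n * l ^ n = 1 := by rw [← mul_pow, inv_mul_cancel₀ hl0, one_pow]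
    have hmn : m⁻¹ ^ n * m ^ n = 1 := by rw [← mul_pow, inv_mul_cancel₀ hm0, one_pow]
    simp only [Fin.sum_univ_three, cons_val, he, homRep_apply]
    rw [← inv_pow, map_pow, map_pow, complexFactor_inv, hpow, hpow']
    simp only [mul_add, add_mul, smul_mul_assoc, mul_smul_comm, smul_add, smul_smul]
    generalize l⁻¹ ^ n = x1, l ^ n = x2, m⁻¹ ^ n = x3, m ^ n = x4 at *
    have h1 : x1 * x3 * (x3 * x2) = x3 ^ 2 := by linear_combination x3 ^ 2 * hln
    have h2 : x1 * x3 * (x3 * x1) = x1 ^ 2 * x3 ^ 2 := by ring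
    have h3 : x1 * x3 * (x4 * x2) = 1 := by linear_combination x3 * x4 * hln + hmn
    have h4 : x1 * x3 * (x4 * x1) = x1 ^ 2 := by linear_combination x1 ^ 2 * hmn
    rw [h1, h2, h3, h4, one_smul]
    abel

end RepresentationProperties

section Classification

theorem exists_eq_smul_add_smul {u v : Fin 2 → ℂ} (hu : u ≠ 0) (hv : ∀ c : ℂ, v ≠ c • u)
    (w : Fin 2 → ℂ) : ∃ a b : ℂ, w = a • u + b • v := by
  have hli : LinearIndependent ℂ ![u, v] :=
    (LinearIndependent.pair_iff' hu).2 fun c h => hv c h.symm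
  have hspan := hli.span_eq_top_of_card_eq_finrank (by simp)
  have hw : w ∈ Submodule.span ℂ (Set.range ![u, v]) := hspan ▸ Submodule.mem_top
  rw [range_cons_cons_empty, Submodule.mem_span_pair] at hw
  obtain ⟨a, b, h⟩ := hw
  exact ⟨a, b, h.symm⟩

/-- Burnside's theorem for `2 × 2` matrices. -/
theorem subalgebra_eq_top_of_no_line {D : Subalgebra ℂ (Matrix (Fin 2) (Fin 2) ℂ)}
    (hD : ∀ u : Fin 2 → ℂ, u ≠ 0 → ∃ b ∈ D, ∀ c : ℂ, b *ᵥ u ≠ c • u) : D = ⊤ := by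
  have htrans {u : Fin 2 → ℂ} (hu : u ≠ 0) (w : Fin 2 → ℂ) : ∃ b ∈ D, b *ᵥ u = w := by
    obtain ⟨b, hb, hbu⟩ := hD u hu
    obtain ⟨x, y, rfl⟩ := exists_eq_smul_add_smul hu hbu w
    refine ⟨x • 1 + y • b, D.add_mem (D.smul_mem D.one_mem x) (D.smul_mem hb y), ?_⟩
    rw [add_mulVec, smul_mulVec, smul_mulVec, one_mulVec]
  obtain ⟨b, hb, hbe⟩ := hD (Pi.single 0 1) (by simp)
  obtain ⟨l, hl⟩ := Module.End.exists_eigenvalue (Matrix.toLin' b)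
  obtain ⟨u, hul, hu⟩ := hl.exists_hasEigenvector
  have hul : b *ᵥ u = l • u := by simpa using Module.End.mem_eigenspace_iff.1 hul
  set r := b - l • (1 : Matrix (Fin 2) (Fin 2) ℂ) with hr
  have hrD : r ∈ D := D.sub_mem hb (D.smul_mem D.one_mem l)
  have hru : r *ᵥ u = 0 := by rw [hr, sub_mulVec, smul_mulVec, one_mulVec, hul, sub_self]
  set v : Fin 2 → ℂ := Pi.single 0 1 with hv
  have hrv : r *ᵥ v ≠ 0 := by
    rw [hr, sub_mulVec, smul_mulVec, one_mulVec, sub_ne_zero]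
    exact hbe l
  have huv (c : ℂ) : v ≠ c • u := fun h => hrv (by rw [h, mulVec_smul, hru, smul_zero])
  have hkill (w : Fin 2 → ℂ) : ∃ d ∈ D, d *ᵥ u = 0 ∧ d *ᵥ v = w := by
    obtain ⟨d, hd, hdw⟩ := htrans hrv w
    exact ⟨d * r, D.mul_mem hd hrD, by rw [← mulVec_mulVec, hru, mulVec_zero],
      by rw [← mulVec_mulVec, hdw]⟩
  obtain ⟨s, hs, hsu⟩ := htrans hu v
  rw [eq_top_iff]
  rintro M -
  obtain ⟨d, hd, hdw⟩ := htrans hrv (M *ᵥ u)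
  obtain ⟨k, hk, hku, hkv⟩ := hkill (M *ᵥ v - (d * r * s) *ᵥ v)
  have hM : M = d * r * s + k := by
    refine Matrix.toLin'.injective (LinearMap.ext fun w => ?_)
    obtain ⟨x, y, rfl⟩ := exists_eq_smul_add_smul hu huv w
    rw [toLin'_apply, toLin'_apply, mulVec_add, mulVec_add, mulVec_smul, mulVec_smul,
      mulVec_smul, mulVec_smul, add_mulVec, add_mulVec, hku, hkv, ← mulVec_mulVec, ← mulVec_mulVec,
      hsu, hdw, add_zero, add_sub_cancel]
  rw [hM]
  exact D.add_mem (D.mul_mem (D.mul_mem hd hrD) hs) hk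

/-- Goursat's lemma for two simple quotients of an algebra. -/
theorem exists_separating_or_equiv {C A A' : Type*} [Ring C] [Ring A] [Ring A'] [Algebra ℂ C]
    [Algebra ℂ A] [Algebra ℂ A'] [IsSimpleRing A] [IsSimpleRing A'] (p : C →ₐ[ℂ] A) (q : C →ₐ[ℂ] A')
    (hp : Function.Surjective p) (hq : Function.Surjective q) :
    (∃ e, p e = 1 ∧ q e = 0) ∨ ∃ f : A' ≃ₐ[ℂ] A, ∀ c, p c = f (q c) := by
  by_cases h : ∀ c, q c = 0 → p c = 0
  · right
    let f₀ : A' →+* A := (q : C →+* A').liftOfSurjective hq ⟨(p : C →+* A), fun c hc => h c hc⟩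
    have hf (c : C) : f₀ (q c) = p c :=
      (q : C →+* A').liftOfRightInverse_comp_apply _ (Function.rightInverse_surjInv hq)
        ⟨(p : C →+* A), fun c hc => h c hc⟩ c
    let f : A' →ₐ[ℂ] A := ⟨f₀, fun z => by
      have := hf (algebraMap ℂ C z)
      rwa [AlgHom.commutes, AlgHom.commutes] at this⟩
    refine ⟨AlgEquiv.ofBijective f ⟨RingHom.injective (f : A' →+* A), fun a => ?_⟩,
      fun c => (hf c).symm⟩
    obtain ⟨c, rfl⟩ := hp a
    exact ⟨q c, hf c⟩
  · left
    push Not at h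
    obtain ⟨c, hc, hpc⟩ := h
    let J : TwoSidedIdeal A := TwoSidedIdeal.mk' {a | ∃ c, q c = 0 ∧ p c = a}
      ⟨0, map_zero _, map_zero _⟩
      (by
        rintro _ _ ⟨c, hc, rfl⟩ ⟨d, hd, rfl⟩
        exact ⟨c + d, by rw [map_add, hc, hd, add_zero], map_add _ _ _⟩)
      (by
        rintro _ ⟨c, hc, rfl⟩
        exact ⟨-c, by rw [map_neg, hc, neg_zero], map_neg _ _⟩)
      (by
        rintro x _ ⟨c, hc, rfl⟩
        obtain ⟨d, rfl⟩ := hp x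
        exact ⟨d * c, by rw [map_mul, hc, mul_zero], map_mul _ _ _⟩)
      (by
        rintro _ x ⟨c, hc, rfl⟩
        obtain ⟨d, rfl⟩ := hp x
        exact ⟨c * d, by rw [map_mul, hc, zero_mul], map_mul _ _ _⟩)
    have hJ (a : A) : a ∈ J ↔ ∃ c, q c = 0 ∧ p c = a := TwoSidedIdeal.mem_mk' ..
    rcases eq_bot_or_eq_top J with h | h
    · exact absurd ((TwoSidedIdeal.mem_bot A).1 (h ▸ (hJ _).2 ⟨c, hc, rfl⟩)) hpc
    · obtain ⟨e, he, he'⟩ := (hJ 1).1 (h ▸ trivial)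
      exact ⟨e, he', he⟩

/-- The algebra spanned by the image of `SL₂(ℤ)³` under `g ↦ (1, g)`. -/
abbrev BlockAlg : Type := ℂ × (Fin 3 → Matrix (Fin 2) (Fin 2) ℂ)

/-- The projection of `BlockAlg` to its `i`-th block. -/
def blockProj (i : Fin 3) : BlockAlg →ₐ[ℂ] Matrix (Fin 2) (Fin 2) ℂ :=
  (Pi.evalAlgHom ℂ _ i).comp (AlgHom.snd ℂ _ _)

/-- A subalgebra of `BlockAlg` without obvious obstruction is everything. -/
theorem subalgebra_blockAlg_eq_top {C : Subalgebra ℂ BlockAlg}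
    (h1 : ∀ i, ∀ u : Fin 2 → ℂ, u ≠ 0 → ∃ b ∈ C, ∀ c : ℂ, b.2 i *ᵥ u ≠ c • u)
    (h2 : ∀ i j, i ≠ j → ∀ m : Matrix (Fin 2) (Fin 2) ℂ, m ≠ 0 →
      ∃ b ∈ C, b.2 i * m ≠ m * b.2 j) : C = ⊤ := by
  let p (i : Fin 3) : C →ₐ[ℂ] Matrix (Fin 2) (Fin 2) ℂ := (blockProj i).comp C.val
  let p₀ : C →ₐ[ℂ] ℂ := (AlgHom.fst ℂ ℂ _).comp C.val
  have hp (i) : Function.Surjective (p i) := by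
    rw [← AlgHom.range_eq_top]
    refine subalgebra_eq_top_of_no_line fun u hu => ?_
    obtain ⟨b, hb, hbu⟩ := h1 i u hu
    exact ⟨b.2 i, ⟨⟨b, hb⟩, rfl⟩, hbu⟩
  have hp₀ : Function.Surjective p₀ := fun c => ⟨algebraMap ℂ C c, rfl⟩
  have hsep₀ (i) : ∃ e, p₀ e = 1 ∧ p i e = 0 := by
    rcases exists_separating_or_equiv p₀ (p i) hp₀ (hp i) with h | ⟨f, -⟩
    · exact h
    · have := f.toLinearEquiv.finrank_eq
      simp [Module.finrank_matrix] at this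
  have hsep (i j) (hij : i ≠ j) : ∃ e, p i e = 1 ∧ p j e = 0 := by
    rcases exists_separating_or_equiv (p i) (p j) (hp i) (hp j) with h | ⟨f, hf⟩
    · exact h
    · exfalso
      obtain ⟨T, hT⟩ := AlgEquiv.eq_linearEquivConjAlgEquiv
        ((Matrix.toLinAlgEquiv'.symm.trans f).trans Matrix.toLinAlgEquiv')
      obtain ⟨b, hb, hne⟩ := h2 i j hij (LinearMap.toMatrix' T.toLinearMap) (fun h0 => by
        have h0 : T.toLinearMap = 0 := by simpa using h0
        have := T.injective (a₁ := Pi.single 0 1) (a₂ := 0)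
          ((LinearMap.congr_fun h0 _).trans (map_zero T).symm)
        simp at this)
      apply hne
      have h3 := AlgEquiv.congr_fun hT (Matrix.toLinAlgEquiv' (b.2 j))
      have h4 : b.2 i = f (b.2 j) := hf ⟨b, hb⟩
      simp only [AlgEquiv.trans_apply, AlgEquiv.symm_apply_apply, ← h4] at h3
      apply Matrix.toLin'.injective
      rw [Matrix.toLin'_mul, Matrix.toLin'_mul, Matrix.toLin'_toMatrix']
      refine LinearMap.ext fun x => ?_
      have h5 := LinearMap.congr_fun h3 (T x)
      simpa using h5
  have hloc (i : Fin 3) : ∃ e : C, p₀ e = 0 ∧ ∀ j, p j e = if j = i then 1 else 0 := by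
    obtain ⟨e₀, he₀, he₀'⟩ := hsep₀ i
    have key (T : Finset (Fin 3)) :
        ∃ e : C, p₀ e = 0 ∧ p i e = 1 ∧ ∀ j ∈ T, j ≠ i → p j e = 0 := by
      induction T using Finset.induction_on with
      | empty => exact ⟨1 - e₀, by simp [he₀], by simp [he₀'], by simp⟩
      | insert k T _ ih =>
        obtain ⟨e, h0, hi, hT⟩ := ih
        by_cases hk : i = k
        · refine ⟨e, h0, hi, fun j hj hji => ?_⟩
          rcases Finset.mem_insert.1 hj with rfl | hj
          · exact absurd hk.symm hji
          · exact hT j hj hji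
        · obtain ⟨e', hi', hk'⟩ := hsep i k hk
          refine ⟨e * e', by simp [h0], by simp [hi, hi'], fun j hj hji => ?_⟩
          rcases Finset.mem_insert.1 hj with rfl | hj
          · simp [hk']
          · simp [hT j hj hji]
    obtain ⟨e, h0, hi, hT⟩ := key Finset.univ
    refine ⟨e, h0, fun j => ?_⟩
    split_ifs with h
    · rw [h, hi]
    · exact hT j (Finset.mem_univ j) h
  have hloc₀ : ∃ e : C, p₀ e = 1 ∧ ∀ j, p j e = 0 := by
    choose e he he' using hsep₀
    refine ⟨e 0 * e 1 * e 2, by simp [he], fun j => ?_⟩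
    fin_cases j <;> simp [he']
  obtain ⟨ε₀, hε₀, hε₀'⟩ := hloc₀
  choose ε hε hε' using hloc
  rw [eq_top_iff]
  rintro b -
  choose c hc using fun i => hp i (b.2 i)
  have hb : b = (b.1 • ε₀ + ∑ i, c i * ε i : C) := by
    have hp₀' (c : C) : c.1.1 = p₀ c := rfl
    have hp' (c : C) (j : Fin 3) : c.1.2 j = p j c := rfl
    refine Prod.ext ?_ (funext fun j => ?_)
    · rw [hp₀']
      simp [hε₀, hε]
    · rw [hp']
      simp [hε₀', hε', hc]
  rw [hb]
  exact Subtype.prop _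

end Classification

theorem ite_one_zero_le_of_imp {p q : Prop} {_ : Decidable p} {_ : Decidable q} (h : p → q) :
    (if p then (1 : ℝ) else 0) ≤ if q then 1 else 0 := by
  split_ifs with hp hq <;> first | exact absurd (h hp) hq | norm_num

section Subspaces

open Module

/-- The embedding of `SL₂(ℤ)³` into the algebra `ℂ × M₂(ℂ)³`. -/
noncomputable def blockHom : GammaSL →* BlockAlg :=
  (1 : GammaSL →* ℂ).prod (MonoidHom.pi complexFactor)

theorem blockHom_inv_mul_cancel (g : GammaSL) : blockHom g⁻¹ * blockHom g = 1 := by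
  rw [← map_mul, inv_mul_cancel, map_one]

theorem blockHom_mul_inv_cancel (g : GammaSL) : blockHom g * blockHom g⁻¹ = 1 := by
  rw [← map_mul, mul_inv_cancel, map_one]

/-- The translate of a subspace by the inverse of `h`. -/
noncomputable def invTranslate (h : GammaSL) (W : Submodule ℂ BlockAlg) : Submodule ℂ BlockAlg :=
  W.comap (LinearMap.mulLeft ℂ (blockHom h))

theorem mem_invTranslate {h : GammaSL} {W : Submodule ℂ BlockAlg} {x : BlockAlg} :
    x ∈ invTranslate h W ↔ blockHom h * x ∈ W := Iff.rfl

theorem invTranslate_inv_invTranslate (h : GammaSL) (W : Submodule ℂ BlockAlg) :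
    invTranslate h⁻¹ (invTranslate h W) = W := by
  ext x
  rw [mem_invTranslate, mem_invTranslate, ← mul_assoc, blockHom_mul_inv_cancel, one_mul]

theorem finrank_invTranslate (h : GammaSL) (W : Submodule ℂ BlockAlg) :
    finrank ℂ (invTranslate h W) = finrank ℂ W := by
  have key (h : GammaSL) (W : Submodule ℂ BlockAlg) :
      finrank ℂ (invTranslate h W) ≤ finrank ℂ W := by
    refine LinearMap.finrank_le_finrank_of_injective
      (f := (LinearMap.mulLeft ℂ (blockHom h)).restrict fun x hx => hx) fun x y hxy => ?_
    have hxy' : blockHom h * (x : BlockAlg) = blockHom h * y := congrArg Subtype.val hxy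
    have := congrArg (blockHom h⁻¹ * ·) hxy'
    simp only [← mul_assoc, blockHom_inv_mul_cancel, one_mul] at this
    exact Subtype.ext this
  refine (key h W).antisymm ?_
  exact (congrArg (fun V : Submodule ℂ BlockAlg => finrank ℂ V)
    (invTranslate_inv_invTranslate h W)).symm.le.trans (key h⁻¹ (invTranslate h W))

theorem finrank_inf_invTranslate_lt {h h' : GammaSL} {W : Submodule ℂ BlockAlg}
    (hne : invTranslate h W ≠ invTranslate h' W) :
    finrank ℂ (invTranslate h W ⊓ invTranslate h' W : Submodule ℂ BlockAlg) < finrank ℂ W := by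
  rw [← finrank_invTranslate h W]
  refine Submodule.finrank_lt_finrank_of_lt (inf_le_left.lt_of_ne fun heq => hne ?_)
  exact Submodule.eq_of_le_of_finrank_eq (inf_eq_left.1 heq)
    (by rw [finrank_invTranslate, finrank_invTranslate])

/-- The algebra of the elements preserving a subspace. -/
noncomputable def subspaceStabilizer (W : Submodule ℂ BlockAlg) : Subalgebra ℂ BlockAlg where
  carrier := {b | ∀ w ∈ W, b * w ∈ W}
  mul_mem' ha hb w hw := by
    rw [mul_assoc]
    exact ha _ (hb w hw)
  add_mem' ha hb w hw := by
    rw [add_mul]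
    exact W.add_mem (ha w hw) (hb w hw)
  algebraMap_mem' c w hw := by
    rw [← Algebra.smul_def]
    exact W.smul_mem c hw

theorem mem_subspaceStabilizer {W : Submodule ℂ BlockAlg} {b : BlockAlg} :
    b ∈ subspaceStabilizer W ↔ ∀ w ∈ W, b * w ∈ W := Iff.rfl

theorem mul_inv_mem_subspaceStabilizer {h h' : GammaSL} {W : Submodule ℂ BlockAlg}
    (heq : invTranslate h W = invTranslate h' W) :
    blockHom (h * h'⁻¹) ∈ subspaceStabilizer W := by
  intro w hw
  have : blockHom h'⁻¹ * w ∈ invTranslate h W := by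
    rwa [heq, mem_invTranslate, ← mul_assoc, blockHom_mul_inv_cancel, one_mul]
  rwa [mem_invTranslate, ← mul_assoc, ← map_mul] at this

theorem eq_top_of_subspaceStabilizer_eq_top {W : Submodule ℂ BlockAlg}
    (htop : subspaceStabilizer W = ⊤) {g : GammaSL} (hg : blockHom g ∈ W) : W = ⊤ := by
  refine Submodule.eq_top_iff'.2 fun x => ?_
  have := mem_subspaceStabilizer.1 (htop ▸ Algebra.mem_top : x * blockHom g⁻¹ ∈ _) _ hg
  rwa [mul_assoc, blockHom_inv_mul_cancel, mul_one] at this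

variable {S : Finset GammaSL}

attribute [local instance] Matrix.normedAddCommGroup Matrix.normedSpace

open Classical in
/-- The random walk stays in a translate of a proper subalgebra with exponentially small
probability. -/
theorem exists_walkExp_subalgebra_le (hSne : S.Nonempty) (hS : ∀ s ∈ S, s⁻¹ ∈ S)
    (hd : ZariskiDense (Subgroup.closure (S : Set GammaSL))) :
    ∃ r : ℝ, 0 < r ∧ r < 1 ∧ ∀ C : Subalgebra ℂ BlockAlg, C ≠ ⊤ → ∀ (h : GammaSL) (n : ℕ),
      walkExp S n (fun g => if blockHom (h * g⁻¹) ∈ C then 1 else 0) ≤ r ^ n := by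
  have h1 (i : Fin 3) := exists_walkExp_line_le hSne hS (movesVectors_stdRep hd i)
    (hasProximalSequence_stdRep hd i)
  have h2 (p : Fin 3 × Fin 3) : ∃ r : ℝ, 0 < r ∧ r < 1 ∧ (p.1 ≠ p.2 →
      ∀ x : Matrix (Fin 2) (Fin 2) ℂ, x ≠ 0 → ∀ (h : GammaSL) (n : ℕ),
      walkExp S n (fun g => if ∃ c : ℂ, homRep p.1 p.2 (h * g⁻¹) x = c • x then 1 else 0)
        ≤ r ^ n) := by
    by_cases hp : p.1 = p.2
    · exact ⟨1 / 2, by norm_num, by norm_num, fun h => absurd hp h⟩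
    · obtain ⟨r, hr0, hr1, hr⟩ := exists_walkExp_line_le hSne hS (movesVectors_homRep hd hp)
        (hasProximalSequence_homRep hd p.1 p.2)
      exact ⟨r, hr0, hr1, fun _ => hr⟩
  choose r hr0 hr1 hr using h1
  choose q hq0 hq1 hq using h2
  obtain ⟨i₀, hi₀⟩ := Finite.exists_max r
  obtain ⟨p₀, hp₀⟩ := Finite.exists_max q
  refine ⟨max (r i₀) (q p₀), lt_max_of_lt_left (hr0 _), max_lt (hr1 _) (hq1 _),
    fun C hC h n => ?_⟩
  have hcases : (∃ i, ∃ u : Fin 2 → ℂ, u ≠ 0 ∧ ∀ b ∈ C, ∃ c : ℂ, b.2 i *ᵥ u = c • u) ∨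
      ∃ i j, i ≠ j ∧ ∃ m : Matrix (Fin 2) (Fin 2) ℂ, m ≠ 0 ∧ ∀ b ∈ C, b.2 i * m = m * b.2 j := by
    by_contra! hcon
    exact hC (subalgebra_blockAlg_eq_top hcon.1 hcon.2)
  rcases hcases with ⟨i, u, hu, hb⟩ | ⟨i, j, hij, m, hm, hb⟩
  · calc _ ≤ _ := walkExp_mono n fun g => ?_
      _ ≤ r i ^ n := hr i u hu h n
      _ ≤ _ := pow_le_pow_left₀ (hr0 i).le ((hi₀ i).trans (le_max_left _ _)) n
    refine ite_one_zero_le_of_imp fun hg => ?_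
    exact hb _ hg
  · calc _ ≤ _ := walkExp_mono n fun g => ?_
      _ ≤ q (i, j) ^ n := hq (i, j) hij m hm h n
      _ ≤ _ := pow_le_pow_left₀ (hq0 _).le ((hp₀ _).trans (le_max_right _ _)) n
    refine ite_one_zero_le_of_imp fun hg => ⟨1, ?_⟩
    rw [one_smul, homRep_apply, ← mul_assoc]
    refine (congrArg (· * complexFactor j (h * g⁻¹)⁻¹) (hb _ hg)).trans ?_
    change m * complexFactor j (h * g⁻¹) * complexFactor j (h * g⁻¹)⁻¹ = m
    rw [mul_assoc, ← map_mul, mul_inv_cancel, map_one, mul_one]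

open Classical in
theorem walkExp_sq_subspace_le (hSne : S.Nonempty) (W : Submodule ℂ BlockAlg) (a b : ℕ) :
    walkExp S (a + b) (fun g => if blockHom g ∈ W then (1 : ℝ) else 0) ^ 2 ≤
      walkExp S a fun h => walkExp S a fun h' => walkExp S b fun g =>
        if blockHom g ∈ invTranslate h W ⊓ invTranslate h' W then 1 else 0 := by
  rw [walkExp_add, walkExp_comm]
  refine (walkExp_sq_le hSne _ _).trans (le_of_eq ?_)
  simp_rw [walkExp_comm (m := a) (n := b)]
  congr 1
  ext g
  rw [sq, ← smul_eq_mul, ← map_smul]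
  congr 1
  ext h
  rw [Pi.smul_apply, smul_eq_mul, mul_comm, ← smul_eq_mul, ← map_smul]
  congr 1
  ext h'
  simp only [Pi.smul_apply, smul_eq_mul, Submodule.mem_inf, mem_invTranslate, map_mul]
  split_ifs <;> simp_all

open Classical in
/-- The random walk lies in a proper subspace with exponentially small probability. -/
theorem exists_walkExp_subspace_le (hSne : S.Nonempty) (hS : ∀ s ∈ S, s⁻¹ ∈ S)
    (hd : ZariskiDense (Subgroup.closure (S : Set GammaSL))) (d : ℕ) :
    ∃ C r : ℝ, 0 < C ∧ 0 < r ∧ r < 1 ∧ ∀ W : Submodule ℂ BlockAlg, W ≠ ⊤ → finrank ℂ W ≤ d →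
      ∀ l, walkExp S l (fun g => if blockHom g ∈ W then (1 : ℝ) else 0) ≤ C * r ^ l := by
  obtain ⟨r₁, hr₁0, hr₁1, hr₁⟩ := exists_walkExp_subalgebra_le hSne hS hd
  induction d with
  | zero =>
    refine ⟨1, 1 / 2, one_pos, by norm_num, by norm_num, fun W _ hW l => ?_⟩
    have h0 : W = ⊥ := Submodule.finrank_eq_zero.1 (Nat.le_zero.1 hW)
    have hz : (fun g => if blockHom g ∈ W then (1 : ℝ) else 0) = 0 := by
      ext g
      refine if_neg fun hg => ?_
      rw [h0, Submodule.mem_bot] at hg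
      exact one_ne_zero (congrArg Prod.fst hg)
    rw [hz, map_zero]
    positivity
  | succ d ih =>
    obtain ⟨C, r₂, hC, hr₂0, hr₂1, hr₂⟩ := ih
    set r := max r₁ r₂ with hr
    have hr0 : 0 < r := lt_max_of_lt_left hr₁0
    have hr1 : r < 1 := max_lt hr₁1 hr₂1
    obtain ⟨t, ht0, htr⟩ : ∃ t : ℝ, 0 < t ∧ t ^ 4 = r :=
      ⟨√√r, by positivity, by
        rw [show 4 = 2 * 2 from rfl, pow_mul, Real.sq_sqrt (Real.sqrt_nonneg _),
          Real.sq_sqrt hr0.le]⟩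
    have ht1 : t < 1 := lt_of_pow_lt_pow_left₀ 4 zero_le_one (by rwa [htr, one_pow])
    refine ⟨(C + 1) / t, t, by positivity, ht0, ht1, fun W hWt hW l => ?_⟩
    by_cases htop : subspaceStabilizer W = ⊤
    · have hz : (fun g => if blockHom g ∈ W then (1 : ℝ) else 0) = 0 := by
        ext g
        exact if_neg fun hg => hWt (eq_top_of_subspaceStabilizer_eq_top htop hg)
      rw [hz, map_zero]
      positivity
    have hsq : walkExp S l (fun g => if blockHom g ∈ W then (1 : ℝ) else 0) ^ 2 ≤
        (C + 1) * r ^ (l / 2) := by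
      obtain ⟨b, hb, hl⟩ : ∃ b, l / 2 ≤ b ∧ l / 2 + b = l := ⟨l - l / 2, by omega, by omega⟩
      have hle := walkExp_sq_subspace_le hSne W (l / 2) b
      rw [hl] at hle
      have hbound (h h' : GammaSL) : (walkExp S b fun g =>
          if blockHom g ∈ invTranslate h W ⊓ invTranslate h' W then (1 : ℝ) else 0) ≤
          C * r ^ (l / 2) + if blockHom (h * h'⁻¹) ∈ subspaceStabilizer W then 1 else 0 := by
        by_cases heq : invTranslate h W = invTranslate h' W
        · rw [if_pos (mul_inv_mem_subspaceStabilizer heq)]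
          refine (walkExp_mono (F' := fun _ => 1) b fun g => ?_).trans ?_
          · split_ifs <;> norm_num
          · rw [walkExp_const hSne]
            linarith [show 0 < C * r ^ (l / 2) by positivity]
        · have hlt := finrank_inf_invTranslate_lt heq
          have hnt : (invTranslate h W ⊓ invTranslate h' W : Submodule ℂ BlockAlg) ≠ ⊤ := by
            intro h0
            rw [h0, finrank_top] at hlt
            exact absurd (Submodule.finrank_le W) hlt.not_ge
          have h3 : r₂ ^ b ≤ r ^ (l / 2) :=
            (pow_le_pow_left₀ hr₂0.le (le_max_right _ _) b).trans
              (pow_le_pow_of_le_one hr0.le hr1.le hb)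
          refine (hr₂ _ hnt (by omega) b).trans ?_
          refine (mul_le_mul_of_nonneg_left h3 hC.le).trans (le_add_of_nonneg_right ?_)
          split_ifs <;> norm_num
      have hinner (h : GammaSL) : (walkExp S (l / 2) fun h' => C * r ^ (l / 2) +
          if blockHom (h * h'⁻¹) ∈ subspaceStabilizer W then (1 : ℝ) else 0) ≤
          (C + 1) * r ^ (l / 2) := by
        have h4 : r₁ ^ (l / 2) ≤ r ^ (l / 2) := pow_le_pow_left₀ hr₁0.le (le_max_left _ _) _
        have := map_add (walkExp S (l / 2)) (fun _ => C * r ^ (l / 2))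
          fun h' => if blockHom (h * h'⁻¹) ∈ subspaceStabilizer W then (1 : ℝ) else 0
        rw [walkExp_const hSne] at this
        refine this.le.trans ?_
        linarith [hr₁ _ htop h (l / 2)]
      calc _ ≤ _ := hle
        _ ≤ walkExp S (l / 2) fun _ => (C + 1) * r ^ (l / 2) := walkExp_mono _ fun h =>
          (walkExp_mono _ fun h' => hbound h h').trans (hinner h)
        _ = _ := walkExp_const hSne _ _
    refine abs_le_of_sq_le_sq' ?_ (by positivity) |>.2
    refine hsq.trans ?_
    rw [← htr, ← pow_mul]
    have h5 : t ^ (4 * (l / 2)) * t ^ 2 ≤ t ^ (2 * l) := by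
      rw [← pow_add]
      exact pow_le_pow_of_le_one ht0.le ht1.le (by omega)
    rw [div_mul_eq_mul_div, div_pow, le_div_iff₀ (by positivity), mul_assoc, mul_pow, ← pow_mul,
      mul_comm l 2]
    refine mul_le_mul ?_ h5 (by positivity) (by positivity)
    nlinarith

end Subspaces

section Support

variable {G : Type*} [Group G] [DecidableEq G] {S : Finset G}

theorem walkExp_mono_of_mem_pow (n : ℕ) {F F' : G → ℝ} (h : ∀ g ∈ S ^ n, F g ≤ F' g) :
    walkExp S n F ≤ walkExp S n F' := by
  induction n generalizing F F' with
  | zero => exact h 1 (by simp)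
  | succ n ih =>
    rw [walkExp_succ, walkExp_succ]
    gcongr with s hs
    exact ih fun g hg => h _ (pow_succ S n ▸ Finset.mul_mem_mul hg hs)

theorem walkExp_congr_of_mem_pow (n : ℕ) {F F' : G → ℝ} (h : ∀ g ∈ S ^ n, F g = F' g) :
    walkExp S n F = walkExp S n F' :=
  (walkExp_mono_of_mem_pow n fun g hg => (h g hg).le).antisymm
    (walkExp_mono_of_mem_pow n fun g hg => (h g hg).ge)

end Support

section Convolution

open Classical in
theorem chiIter_eq_walkExp {S : Set GammaSL} (hS : S.Finite) (l : ℕ) (x : GammaSL) :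
    chiIter S l x = walkExp hS.toFinset l (Pi.single x 1) := by
  induction l generalizing x with
  | zero =>
    rw [walkExp_zero, Pi.single_apply]
    simp only [chiIter, eq_comm]
  | succ l ih =>
    have hsupp : (Function.support fun y => chiS S y * chiIter S l (x * y⁻¹)) ⊆ hS.toFinset := by
      intro y hy
      by_contra hyS
      exact hy (by simp [chiS, Set.indicator_of_notMem (show y ∉ S by simpa using hyS)])
    rw [chiIter, convG, finsum_eq_sum_of_support_subset _ hsupp, walkExp_succ, Finset.mul_sum]
    refine Finset.sum_congr rfl fun s hs => ?_
    rw [ih, chiS, Set.indicator_of_mem (hS.mem_toFinset.1 hs), Set.ncard_eq_toFinset_card S hS]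
    congr 2
    ext g
    simp only [Pi.single_apply, eq_mul_inv_iff_mul_eq]

open Classical in
theorem finsum_mem_chiIter {S : Set GammaSL} (hS : S.Finite) (l : ℕ) (A : Set GammaSL) :
    ∑ᶠ g ∈ A, chiIter S l g = walkExp hS.toFinset l fun g => if g ∈ A then 1 else 0 := by
  set T := hS.toFinset with hT
  have hsupp : Function.support (A.indicator (chiIter S l)) ⊆ ↑(T ^ l) := by
    intro x hx
    by_contra hxT
    refine hx ?_
    rw [Set.indicator_apply_eq_zero, chiIter_eq_walkExp hS]
    refine fun _ => (walkExp_congr_of_mem_pow l fun g hg => ?_).trans (map_zero _)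
    rw [Pi.zero_apply, Pi.single_eq_of_ne]
    rintro rfl
    exact hxT hg
  rw [finsum_mem_def, finsum_eq_sum_of_support_subset _ hsupp]
  have hcongr : walkExp T l (fun g => if g ∈ A then 1 else 0) =
      walkExp T l (∑ x ∈ T ^ l, (if x ∈ A then (1 : ℝ) else 0) • Pi.single x (1 : ℝ)) := by
    refine walkExp_congr_of_mem_pow l fun g hg => ?_
    rw [Finset.sum_apply, Finset.sum_eq_single g (fun x _ hx => by simp [hx.symm])
      fun h => absurd hg h]
    simp
  rw [hcongr, map_sum]
  refine Finset.sum_congr rfl fun x _ => ?_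
  rw [map_smul, ← chiIter_eq_walkExp hS, Set.indicator_apply]
  split_ifs <;> simp

end Convolution

section Lifting

open Classical in
/-- The entries of the elements of `S ^ l` grow at most exponentially. -/
theorem exists_entryZ_le (S : Finset GammaSL) :
    ∃ M : ℕ, 1 ≤ M ∧ ∀ l, ∀ g ∈ S ^ l, ∀ x, |entryZ g x| ≤ (M : ℤ) ^ l := by
  set m : ℕ := ∑ s ∈ S, ∑ x, (entryZ s x).natAbs with hm
  have hle (s) (hs : s ∈ S) (x) : |entryZ s x| ≤ m := by
    rw [Int.abs_eq_natAbs, Nat.cast_le]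
    exact (Finset.single_le_sum (f := fun x => (entryZ s x).natAbs) (fun _ _ => Nat.zero_le _)
      (Finset.mem_univ x)).trans (Finset.single_le_sum
        (f := fun s => ∑ x, (entryZ s x).natAbs) (fun _ _ => Nat.zero_le _) hs)
  refine ⟨2 * m + 1, by omega, fun l => ?_⟩
  induction l with
  | zero =>
    intro g hg x
    obtain ⟨i, a, b⟩ := x
    rw [pow_zero, Finset.mem_one] at hg
    rw [hg, entryZ_apply, map_one, Matrix.SpecialLinearGroup.coe_one, Matrix.one_apply]
    split_ifs <;> simp
  | succ l ih =>
    intro g hg x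
    obtain ⟨i, a, b⟩ := x
    rw [pow_succ] at hg
    obtain ⟨h, hh, s, hs, rfl⟩ := Finset.mem_mul.1 hg
    have hmul : entryZ (h * s) (i, a, b) =
        entryZ h (i, a, 0) * entryZ s (i, 0, b) + entryZ h (i, a, 1) * entryZ s (i, 1, b) := by
      simp only [entryZ_apply, map_mul, Matrix.SpecialLinearGroup.coe_mul, Matrix.mul_apply,
        Fin.sum_univ_two]
    have key (c) : |entryZ h (i, a, c) * entryZ s (i, c, b)| ≤ ((2 * m + 1 : ℕ) : ℤ) ^ l * m := by
      rw [abs_mul]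
      exact mul_le_mul (ih h hh _) (hle s hs _) (abs_nonneg _) (by positivity)
    rw [hmul, pow_succ]
    refine (abs_add_le _ _).trans ?_
    have hpos : (0 : ℤ) ≤ ((2 * m + 1 : ℕ) : ℤ) ^ l := by positivity
    have := key 0
    have := key 1
    push_cast at *
    nlinarith

/-- The vector of the entries of an element of `SL₂(ℤ)³`, with a constant coordinate added. -/
def augEntries (g : GammaSL) : Option (Fin 3 × Fin 2 × Fin 2) → ℤ
  | none => 1
  | some x => entryZ g x

theorem dvd_det_augEntries {X : Fin 3 × Fin 2 × Fin 2 → ℤ} (hX : PrimitiveForm X) {Q n : ℤ}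
    (g : Option (Fin 3 × Fin 2 × Fin 2) → GammaSL) (hg : ∀ k, Lform X (g k) ≡ n [ZMOD Q]) :
    Q ∣ (Matrix.of fun k => augEntries (g k)).det := by
  set D := Matrix.of fun k => augEntries (g k) with hD
  let c : Option (Fin 3 × Fin 2 × Fin 2) → ℤ := fun k => k.elim (-n) X
  have hc (k) : Q ∣ (D *ᵥ c) k := by
    have : (D *ᵥ c) k = Lform X (g k) - n := by
      simp only [mulVec, dotProduct, Fintype.sum_option, Lform, hD, Matrix.of_apply, augEntries, c,
        Option.elim, mul_comm]
      ring
    rw [this]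
    exact (hg k).symm.dvd
  have hdet (x) : Q ∣ D.det * X x := by
    have : (D.adjugate *ᵥ (D *ᵥ c)) (some x) = D.det * X x := by
      rw [mulVec_mulVec, adjugate_mul, smul_mulVec, one_mulVec]
      rfl
    rw [← this]
    change Q ∣ ∑ k, D.adjugate (some x) k * (D *ᵥ c) k
    exact Finset.dvd_sum fun k _ => (hc k).mul_left _
  have := Finset.dvd_gcd (s := Finset.univ) fun x _ => hdet x
  rw [Finset.gcd_mul_left, show Finset.univ.gcd X = 1 from hX, mul_one] at this
  exact (dvd_normalize_iff).1 this

/-- Complex coordinates on `BlockAlg`. -/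
def blockCoords : BlockAlg →ₗ[ℂ] (Option (Fin 3 × Fin 2 × Fin 2) → ℂ) where
  toFun b k := k.elim b.1 fun x => b.2 x.1 x.2.1 x.2.2
  map_add' b b' := by
    ext k
    cases k <;> rfl
  map_smul' c b := by
    ext k
    cases k <;> rfl

theorem blockCoords_surjective : Function.Surjective blockCoords := fun f =>
  ⟨(f none, fun i => Matrix.of fun a b => f (some (i, a, b))), by
    ext k
    cases k <;> rfl⟩

theorem blockCoords_blockHom (g : GammaSL) :
    blockCoords (blockHom g) = fun k => (augEntries g k : ℂ) := by
  ext k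
  cases k with
  | none => exact Int.cast_one.symm
  | some x => exact complexFactor_apply _ _ _ _

open Classical in
/-- The elements of a short ball satisfying a primitive linear congruence lie in a proper
subspace. -/
theorem exists_subspace_of_congruence {A : Set GammaSL} {M Q : ℕ}
    (hM : ∀ g ∈ A, ∀ k, |augEntries g k| ≤ M) (hQ : Nat.factorial 13 * M ^ 13 < Q)
    {X : Fin 3 × Fin 2 × Fin 2 → ℤ} (hX : PrimitiveForm X) {n : ℤ}
    (hA : ∀ g ∈ A, Lform X g ≡ n [ZMOD (Q : ℤ)]) :
    ∃ W : Submodule ℂ BlockAlg, W ≠ ⊤ ∧ ∀ g ∈ A, blockHom g ∈ W := by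
  let v (g : GammaSL) : Option (Fin 3 × Fin 2 × Fin 2) → ℂ := fun k => (augEntries g k : ℂ)
  have hspan : Submodule.span ℂ (v '' A) ≠ ⊤ := by
    intro htop
    obtain ⟨b, hbA, hb, hli⟩ := exists_linearIndependent ℂ (v '' A)
    let B : Module.Basis b ℂ (Option (Fin 3 × Fin 2 × Fin 2) → ℂ) :=
      Module.Basis.mk hli (by rw [Subtype.range_coe, hb, htop])
    let e : Option (Fin 3 × Fin 2 × Fin 2) ≃ b := (Pi.basisFun ℂ _).indexEquiv B
    choose g hgA hg using fun k => hbA (e k).2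
    have hdet : (Matrix.of fun k => augEntries (g k)).det ≠ 0 := by
      intro h0
      have hli' : LinearIndependent ℂ
          ((Matrix.of fun k => augEntries (g k)).map (Int.castRingHom ℂ)).row := by
        have hrow : ((Matrix.of fun k => augEntries (g k)).map (Int.castRingHom ℂ)).row =
            Subtype.val ∘ e := funext hg
        rw [hrow]
        exact hli.comp e e.injective
      rw [linearIndependent_rows_iff_isUnit, isUnit_iff_isUnit_det, ← RingHom.mapMatrix_apply,
        ← RingHom.map_det, h0, map_zero] at hli'
      exact not_isUnit_zero hli'
    have hdvd := dvd_det_augEntries hX g fun k => hA _ (hgA k)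
    have hle := Matrix.det_le (abv := AbsoluteValue.abs)
      (A := Matrix.of fun k => augEntries (g k)) fun k j => hM _ (hgA k) j
    have hQle := Int.le_of_dvd (abs_pos.2 hdet) ((dvd_abs _ _).2 hdvd)
    have hcard : Fintype.card (Option (Fin 3 × Fin 2 × Fin 2)) = 13 := rfl
    rw [hcard, nsmul_eq_mul] at hle
    exact absurd (hQle.trans hle) (not_le.2 (by exact_mod_cast hQ))
  refine ⟨(Submodule.span ℂ (v '' A)).comap blockCoords, fun htop => hspan ?_, fun g hg => ?_⟩
  · refine Submodule.eq_top_iff'.2 fun f => ?_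
    obtain ⟨x, rfl⟩ := blockCoords_surjective f
    exact Submodule.mem_comap.1 (htop ▸ Submodule.mem_top)
  · rw [Submodule.mem_comap, blockCoords_blockHom]
    exact Submodule.subset_span ⟨g, hg, rfl⟩

end Lifting

theorem ZariskiDense.nonempty {S : Set GammaSL} (hd : ZariskiDense (Subgroup.closure S)) :
    S.Nonempty := by
  rw [Set.nonempty_iff_ne_empty]
  rintro rfl
  obtain ⟨γ, hγ, h⟩ := hd.exists_hyperbolic
  rw [Subgroup.closure_empty, Subgroup.mem_bot] at hγ
  obtain ⟨t, ht, htr⟩ := h 0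
  rw [hγ, map_one, trace_one, Fintype.card_fin] at htr
  have : t = 2 := by exact_mod_cast htr.symm
  rw [this] at ht
  exact absurd ht (by norm_num)

theorem exists_mul_pow_lt_exp {C r : ℝ} (hr0 : 0 < r) (hr1 : r < 1) :
    ∃ c : ℝ, 0 < c ∧ ∃ l₀ : ℕ, 0 < l₀ ∧ ∀ l : ℕ, l₀ ≤ l → C * r ^ l < Real.exp (-c * l) := by
  have hlog : 0 < -Real.log r := neg_pos.2 (Real.log_neg hr0 hr1)
  obtain ⟨k, hk⟩ := exists_nat_gt (C / (-Real.log r / 2))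
  refine ⟨-Real.log r / 2, by positivity, k + 1, k.succ_pos, fun l hl => ?_⟩
  have hkl : (k : ℝ) ≤ l := by exact_mod_cast (Nat.le_succ k).trans hl
  have hC : C < Real.exp (-Real.log r / 2 * l) := by
    have := (div_lt_iff₀ (by positivity)).1 (hk.trans_le hkl)
    linarith [Real.add_one_le_exp (-Real.log r / 2 * l)]
  have hpow : r ^ l = Real.exp (-(-Real.log r / 2) * l) * Real.exp (-(-Real.log r / 2) * l) := by
    rw [← Real.exp_add, ← Real.exp_log (pow_pos hr0 l), Real.log_pow]
    congr 1
    ring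
  rw [hpow, ← mul_assoc]
  refine mul_lt_of_lt_one_left (Real.exp_pos _) ?_
  rwa [neg_mul, Real.exp_neg, ← div_eq_mul_inv, div_lt_one (Real.exp_pos _)]

theorem pow_lt_of_lt_log {K : ℝ} (hK : 1 < K) {l Q : ℕ} (hQ : 0 < Q)
    (h : (l : ℝ) < (Real.log K)⁻¹ * Real.log Q) : K ^ l < Q := by
  rw [inv_mul_eq_div, lt_div_iff₀ (Real.log_pos hK)] at h
  rw [← Real.log_lt_log_iff (by positivity) (by positivity), Real.log_pow]
  exact h

/-- Exponential non-concentration in fibers of primitive linear forms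
mod `Q`, for walk lengths `l₀ ≤ l < c₁ log Q`. -/
theorem statement9 (S : Set GammaSL) (hfin : S.Finite) (hsym : S⁻¹ = S)
    (hdense : ZariskiDense (Subgroup.closure S)) :
    ∃ c₁ c₂ : ℝ, 0 < c₁ ∧ 0 < c₂ ∧ ∃ l₀ : ℕ, 0 < l₀ ∧
      ∀ X : Fin 3 × Fin 2 × Fin 2 → ℤ, PrimitiveForm X →
        ∀ Q : ℕ, 0 < Q → ∀ n : ℤ, ∀ l : ℕ, l₀ ≤ l → (l : ℝ) < c₁ * Real.log Q →
          (∑ᶠ g ∈ {g : GammaSL | Lform X g ≡ n [ZMOD (Q : ℤ)]}, chiIter S l g) <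
            Real.exp (-c₂ * l) := by
  classical
  have hTS : (hfin.toFinset : Set GammaSL) = S := hfin.coe_toFinset
  obtain ⟨C, r, -, hr0, hr1, hsub⟩ := exists_walkExp_subspace_le (S := hfin.toFinset)
    (hfin.toFinset_nonempty.2 hdense.nonempty)
    (fun s hs => hfin.mem_toFinset.2 <| by
      rw [← hsym]
      exact Set.inv_mem_inv.2 (hfin.mem_toFinset.1 hs))
    (hTS.symm ▸ hdense) (Module.finrank ℂ BlockAlg)
  obtain ⟨c₂, hc₂, l₀, hl₀, hexp⟩ := exists_mul_pow_lt_exp (C := C) hr0 hr1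
  obtain ⟨M, hM1, hM⟩ := exists_entryZ_le hfin.toFinset
  have hK : 1 < ((Nat.factorial 13 * M ^ 13 : ℕ) : ℝ) := by
    exact_mod_cast Nat.one_lt_mul_iff.2
      ⟨Nat.factorial_pos _, by positivity, Or.inl (by decide)⟩
  refine ⟨(Real.log ((Nat.factorial 13 * M ^ 13 : ℕ) : ℝ))⁻¹, c₂, inv_pos.2 (Real.log_pos hK), hc₂,
    l₀, hl₀, fun X hX Q hQ n l hl hlQ => ?_⟩
  have hpow : (Nat.factorial 13 * M ^ 13) ^ l < Q := by
    exact_mod_cast pow_lt_of_lt_log hK hQ hlQ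
  obtain ⟨W, hW, hAW⟩ := exists_subspace_of_congruence
    (A := {g | g ∈ hfin.toFinset ^ l ∧ Lform X g ≡ n [ZMOD (Q : ℤ)]}) (M := M ^ l) (Q := Q)
    (fun g hg k => by
      cases k with
      | none => simpa [augEntries] using one_le_pow₀ (by exact_mod_cast hM1 : (1 : ℤ) ≤ M)
      | some x => exact_mod_cast hM l g hg.1 x)
    (lt_of_le_of_lt (by
      rw [mul_pow, ← pow_mul, ← pow_mul, mul_comm l]
      gcongr
      exact Nat.le_self_pow (by omega) _) hpow) hX fun g hg => hg.2
  rw [finsum_mem_chiIter hfin]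
  refine lt_of_le_of_lt ?_ ((hsub W hW (Submodule.finrank_le W) l).trans_lt (hexp l hl))
  exact walkExp_mono_of_mem_pow l fun g hg => ite_one_zero_le_of_imp fun h => hAW g ⟨hg, h⟩
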